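/- Let B³₃ = {(x₁,x₂,x₃) ∈ ℝ³ : |x₁|³ + |x₂|³ + |x₃|³ ≤ 1} be the superball with parameter p = 3. Then every translative packing of B³₃ has upper density at most 0.8237. -/

import Mathlib

open MeasureTheory Filter Metric

/-- A translative packing of `K`: a set of translation vectors such that the translates
of the interior of `K` are pairwise disjoint. -/
def IsTranslativePacking (K X : Set (EuclideanSpace ℝ (Fin 3))) : Prop :=
  ∀ x ∈ X, ∀ y ∈ X, x ≠ y →
    Disjoint ((fun z => x + z) '' interior K) ((fun z => y + z) '' interior K)

/-- The upper density of a translative packing `X` of the body `K`. -/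
noncomputable def packingUpperDensity (K X : Set (EuclideanSpace ℝ (Fin 3))) : ℝ :=
  Filter.limsup (fun r : ℝ => ⨆ c : EuclideanSpace ℝ (Fin 3),
    (volume (closedBall c r ∩ ⋃ x ∈ X, (fun z => x + z) '' K) /
      volume (closedBall c r)).toReal) Filter.atTop

namespace SB
def qdata : List (ℕ × ℕ × ℕ × ℤ) := [
(0,0,0,1666666666666666668396),
(1,0,0,480991600293031480567),
(2,0,0,-1263356881679958698531),
(1,1,0,-1175990452365046595720),
(3,0,0,311941802105133546942),
(2,1,0,1035440357038579105935),
(1,1,1,205098937298782545088),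
(4,0,0,-41037264165606807005),
(3,1,0,-224945827716195227623),
(2,2,0,-166657770558866575761),
(2,1,1,-321712140937476476347),
(5,0,0,7772131467013062585),
(4,1,0,33287688590363653671),
(3,2,0,131504063007388322096),
(3,1,1,98219259907170401829),
(2,2,1,208426143557110796617),
(6,0,0,-1429751031414497943),
(5,1,0,-3647608095582860308),
(4,2,0,-26606207960507656332),
(4,1,1,-13636000260129733830),
(3,3,0,-25343480168411524947),
(3,2,1,-112484842702613937531),
(2,2,2,-36296208758651689093),
(7,0,0,152641067027252893),
(6,1,0,325853184092845016),
(5,2,0,2675458577051585270),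
(5,1,1,970600542650922311),
(4,3,0,7894529407738461750),
(4,2,1,12476371531375959242),
(3,3,1,13005941159325729790),
(3,2,2,20015602434391924876),
(8,0,0,-9128411267721344),
(7,1,0,-20024698235112800),
(6,2,0,-166179061617725408),
(6,1,1,-51852523454565751),
(5,3,0,-539174538672059108),
(5,2,1,-630824556104170998),
(4,4,0,-483615344165864695),
(4,3,1,-2442260569495371332),
(4,2,2,-1562615245131623230),
(3,3,2,-2712543414413118592),
(9,0,0,306033029333699),
(8,1,0,653944386678168),
(7,2,0,6998931147204125),
(7,1,1,2488164005777399),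
(6,3,0,18167649473857545),
(6,2,1,18424625363385396),
(5,4,0,49700078070994928),
(5,3,1,90077357951783426),
(5,2,2,56633617774082223),
(4,4,1,100437930662950711),
(4,3,2,316069798711169982),
(3,3,3,71259409229146707),
(10,0,0,-5380074250415),
(9,1,0,-8629523540828),
(8,2,0,-170180072720121),
(8,1,1,-68722966914605),
(7,3,0,-347338320890308),
(7,2,1,-492791925437285),
(6,4,0,-1034551913610415),
(6,3,1,-945406021955229),
(6,2,2,-1099756960305212),
(5,5,0,-917190459012449),
(5,4,1,-6104688110650618),
(5,3,2,-7308305882122026),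
(4,4,2,-6978380090271890),
(4,3,3,-7157181155322863),
(11,0,0,38611266435),
(10,1,0,21697825588),
(9,2,0,1628580809341),
(9,1,1,684093173309),
(8,3,0,3375733082955),
(8,2,1,6698092515600),
(7,4,0,7877013240171),
(7,3,1,5480806461166),
(7,2,2,16335183269520),
(6,5,0,20342631002601),
(6,4,1,23905564953437),
(6,3,2,36999528469696),
(5,5,1,75368337061000),
(5,4,2,202041233587593),
(5,3,3,74718944596236),
(4,4,3,123555188150482)]
def mdata : List ℤ := [0, 105787891113959, 259713017646517, -77253880830536, 19941249817028, -3283437551091, 322562228319, -17197282863, 382170733]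
def code0 : ℕ := 0x70000023000326000215000031260060000231231200012002000215400400000023120002300204500045021432150000130000123000023145005000000321300032003054000540315231260000700306000314000070005400007000000000000000031213123132131205cb71300600007000007000000000000023132132313205a671300013000260000145000015400040152601300002130002300031450002045000260402314500007005000070000070000070000070000070000070000070000070000070000123059971233213231450030506030503060000700000700001320000132606e67000031206c07000013206c07000013206b270000312069e70003206b17006a77006ae700669754006a77150005400503206967140005400503206a77150005400503206bd71540005400503206f4715000540005460000125005060050123206e5714500023002500032604006020400604021300000002311320002300204500040150004502314606cb700506a670002600250002150060502306ea710000000231312069376000020460204606ec70000001454015000260000014550126069670000204602046000026040204600015000260012600020460002046000260400020461500040261540000204604026155066774000020460402606be715000040260460206e871450072a723123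
def code1 : ℕ := 0x31213120001200400000021233215300013006000402610060250004501460060400430030605000000100160002604000460112300000200600223131431231006000032100003126300000031213000000013123100000000012132123400600000331230000003321300002310000021130000023130000032314550004500400033231445540060005014000015465000000002004002213231300000204300300305460030600500260060331231620000000300600603121321300000033120000130003100300345500015005001331243543150050306005030620000501501400030005010060305006050050321445005000150050050123214250002300000231200000023132600032460400026020400040002626041500000020002100001230000014326000305200010001263000001432600003050621540003060505200305064150004506003050621000506400306052100005014064000540300506030122145000602026040000266043000204600026000000001554015015401455000023003000260404600340060326040460000000260466020466510000000000000000000000000000000000000000015554015454540155454015454545401554540154545014545540123321323132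

noncomputable section
def sumTo (f : ℕ → ℕ) (n : ℕ) : ℕ := Nat.rec 0 (fun k s => Nat.add s (f k)) n
def onesG (si sj sk sl m : ℕ) : ℕ :=
  sumTo (fun a => sumTo (fun b => Nat.pow 2 (m*si+a*sj+b*sk+(11-m-a-b)*sl)) (12-m-a)) (12-m)
def onesE : ℕ := sumTo (fun m => onesG 0 160 1920 23040 m) 12
def hones : ℕ := Nat.mul (Nat.pow 2 159) onesE
def msk (si sj sk sl m : ℕ) : ℕ := Nat.mul (2^160-1) (onesG si sj sk sl m)
def hor (si sj sk sl Z : ℕ) (n : ℕ) : ℕ → ℕ :=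
  Nat.rec (motive := fun _ => ℕ → ℕ) (fun acc => acc)
   (fun m ih acc => ih (Nat.add (Nat.add (Nat.shiftLeft acc si) (Nat.shiftLeft acc sj))
      (Nat.shiftRight (Nat.land Z (msk si sj sk sl m)) (Nat.mul m si)))) n
def op0 (si sj sk sl Z : ℕ) : ℕ := hor si sj sk sl Z 12 0
def op (si sj sk sl Z : ℕ) : ℕ :=
  Nat.sub (Nat.add (op0 si sj sk sl Z) hones) (op0 si sj sk sl hones)
def gones : ℕ := Nat.mul (Nat.pow 2 138) onesE
def kones : ℕ := Nat.mul (2^160 - 2^139) onesE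
def gtest (Z : ℕ) : Bool := Nat.beq (Nat.land (Nat.add Z gones) kones) hones
def ltest (Z : ℕ) : Bool := Nat.beq (Nat.land Z hones) hones
def opN (si sj sk sl Z : ℕ) : ℕ := Nat.rec 0 (fun _ _ => op si sj sk sl Z) Z
def tsel (d : ℕ) (k : ℕ → ℕ → ℕ → ℕ → Bool) : Bool :=
  match d with
  | 1 => k 0 160 1920 23040
  | 2 => k 0 1920 160 23040
  | 3 => k 0 23040 160 1920
  | 4 => k 160 1920 0 23040
  | 5 => k 160 23040 0 1920
  | 6 => k 1920 23040 0 160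
  | _ => false
def kcom (code P N : ℕ) : ℕ :=
  Nat.sub (Nat.add P (Nat.mul (Nat.mod (Nat.div code 16) (2^16)) N))
    (Nat.mul (Nat.mod (Nat.div code 16) (2^16)) hones)
def stepL (ih : ℕ → List (ℕ × ℕ) → Bool) (code P N : ℕ) (st : List (ℕ × ℕ)) : Bool :=
  Bool.rec
    (Bool.rec
      (and (gtest P) (and (or (Nat.beq N 0) (gtest N))
        (tsel (Nat.mod code 16) fun si sj sk sl =>
          ih (Nat.div code 16) ((op si sj sk sl P, opN si sj sk sl N) ::
            (op sj si sk sl P, opN sj si sk sl N) :: st))))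
      (and (and (gtest P) (gtest N)) (ih (Nat.div code (2^20)) ((kcom code P N, 0) :: st)))
      (Nat.beq (Nat.mod code 16) 7))
    (and (ltest P) (ih (Nat.div code 16) st))
    (Nat.beq (Nat.mod code 16) 0)
def run (fuel : ℕ) : ℕ → List (ℕ × ℕ) → Bool :=
  Nat.rec (motive := fun _ => ℕ → List (ℕ × ℕ) → Bool) (fun _ _ => false)
  (fun _ ih code st => List.rec true (fun ZN st _ => stepL ih code ZN.1 ZN.2 st) st) fuel

section roots
variable {R : Type} [CommRing R]
def mono (i : ℕ) (_t z : R) : R := z ^ i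
def herP (i : ℕ) (t z : R) : R × R :=
  Nat.rec (motive := fun _ => R × R) (0, 1)
    (fun k p => (p.2, (((4*k+1 : ℕ) : R)*t - z) * p.2 - ((2*k*(2*k-1) : ℕ) : R)*t^2 * p.1)) i
def her (i : ℕ) (t z : R) : R := (herP i t z).2
def term (E : ℕ → R → R → R) (t a b c : R) (i j k : ℕ) : R :=
  t ^ (11 - i - j - k) *
    (E i t a * (E j t b * E k t c + E j t c * E k t b)
    + E i t b * (E j t a * E k t c + E j t c * E k t a)
    + E i t c * (E j t b * E k t a + E j t a * E k t b))
def formL (E : ℕ → R → R → R) (t a b c : R) (L : List (ℕ × ℕ × ℕ × ℤ)) : R :=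
  List.rec 0 (fun q _ s => s + (q.2.2.2 : R) * term E t a b c q.1 q.2.1 q.2.2.1) L
def form (E : ℕ → R → R → R) (t a b c : R) : R := formL E t a b c qdata
def mfL (t a : R) (L : List ℤ) (n : ℕ) : R :=
  List.rec (motive := fun _ => ℕ → R) (fun _ => 0)
    (fun m _ s n => (m : R) * t ^ n + a * s (n - 1)) L n
def mform (t a b c : R) : R :=
  (10000000000000000 * t ^ 8 - mfL t a mdata 8 - mfL t b mdata 8 - mfL t c mdata 8)
    * (10 * t + a + b + c) ^ 3
/-- forms in the variables `(t,u,v,w)` -/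
def rootH (x : Fin 4 → R) : R :=
  form mono (x 0) (10*(x 1+x 2+x 3)) (10*(x 2+x 3)) (10*x 3)
def rootF (x : Fin 4 → R) : R :=
  - form her (x 0) (10*(x 1+x 2+x 3)) (10*(x 2+x 3)) (10*x 3)
def rootN (x : Fin 4 → R) : R :=
  mform (x 0) (10*(x 1+x 2+x 3)) (10*(x 2+x 3)) (10*x 3)
end roots
def wt : Fin 4 → ℕ := ![0, 160, 1920, 23040]
def XX : Fin 4 → ℤ := fun i => Int.ofNat (Nat.pow 2 (wt i))
def ZH : ℕ := Int.toNat (Int.ofNat hones + rootH XX)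
def ZF : ℕ := Int.toNat (Int.ofNat hones + rootF XX)
def ZM : ℕ := Int.toNat (Int.ofNat hones + rootN XX)
theorem runH : run 954 code1 [(ZH,0)] = true := by decide +kernel
theorem runF : run 1024 code0 [(ZF,ZM)] = true := by decide +kernel
end
end SB

namespace SB
section bits
variable {α : Type*}

theorem land_shift (Z κ s : ℕ) (hκ : κ < 2^160) :
    Z &&& (κ <<< s) = ((Z >>> s % 2^160) &&& κ) <<< s := by
  apply Nat.eq_of_testBit_eq
  intro i
  simp only [Nat.testBit_and, Nat.testBit_shiftLeft, Nat.testBit_mod_two_pow, Nat.testBit_shiftRight]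
  by_cases h : s ≤ i
  · by_cases h2 : i - s < 160
    · simp [h, h2]
    · have : κ.testBit (i - s) = false :=
        Nat.testBit_lt_two_pow (lt_of_lt_of_le hκ (Nat.pow_le_pow_right (by norm_num) (by omega)))
      simp [this]
  · simp [h]

theorem mask_lt (S : Finset ℕ) (M : ℕ) (h : ∀ x ∈ S, x < M) (d : ℕ → ℕ)
    (hd : ∀ n ∈ S, d n < 2^160) :
    ∑ n ∈ S, d n * 2^(160*n) < 2^(160*M) := by
  have hB : 2 ≤ 2^160 := by norm_num
  have h3 : ∑ n ∈ S, d n * 2^(160*n) ≤ ∑ n ∈ Finset.range M, (2^160-1) * (2^160)^n := by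
    calc _ ≤ ∑ n ∈ S, (2^160-1) * (2^160)^n := by
          apply Finset.sum_le_sum
          intro n hn
          rw [pow_mul]
          exact Nat.mul_le_mul_right _ (by have := hd n hn; omega)
      _ ≤ _ := by
          apply Finset.sum_le_sum_of_subset
          intro x hx; simpa using h x hx
  rw [← Finset.mul_sum, mul_comm, Nat.geomSum_eq hB] at h3
  have h4 : ((2^160)^M - 1)/(2^160-1) * (2^160-1) ≤ (2^160)^M - 1 := Nat.div_mul_le_self _ _
  have h5 : 0 < (2^160)^M := by positivity
  rw [pow_mul]
  omega

theorem land_mask (Z κ : ℕ) (hκ : κ < 2^160) (S : Finset ℕ) :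
    Z &&& (κ * ∑ n ∈ S, 2^(160*n)) = ∑ n ∈ S, ((Z >>> (160*n) % 2^160) &&& κ) * 2^(160*n) := by
  induction S using Finset.induction_on_max with
  | empty => simp
  | insert M S hM ih =>
    have hn : M ∉ S := fun h => lt_irrefl _ (hM M h)
    rw [Finset.sum_insert hn, Finset.sum_insert hn, ← ih, mul_add]
    have h1 : κ * ∑ n ∈ S, 2^(160*n) < 2^(160*M) := by
      rw [Finset.mul_sum]; exact mask_lt S M hM (fun _ => κ) (fun _ _ => hκ)
    rw [← Nat.shiftLeft_eq, ← Nat.shiftLeft_eq, Nat.shiftLeft_add_eq_or_of_lt h1,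
      Nat.shiftLeft_add_eq_or_of_lt (lt_of_le_of_lt Nat.and_le_right h1), Nat.and_or_distrib_left,
      land_shift _ _ _ hκ]

theorem dig_sum (S : Finset ℕ) (d : ℕ → ℕ) (hd : ∀ n ∈ S, d n < 2^160) (n : ℕ) (hn : n ∈ S) :
    (∑ n ∈ S, d n * 2^(160*n)) >>> (160*n) % 2^160 = d n := by
  have e1 : ∑ m ∈ S, d m * 2^(160*m) = ∑ m ∈ S with m < n, d m * 2^(160*m) + (d n * 2^(160*n)
      + ∑ m ∈ S with n < m, d m * 2^(160*m)) := by
    rw [← Finset.sum_filter_add_sum_filter_not S (· < n)]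
    congr 1
    have : S.filter (fun m => ¬ m < n) = insert n (S.filter (fun m => n < m)) := by
      ext m; simp only [Finset.mem_filter, Finset.mem_insert]; constructor
      · rintro ⟨a, b⟩; rcases Nat.lt_or_ge n m with h | h
        · right; exact ⟨a, h⟩
        · left; omega
      · rintro (rfl | ⟨a, b⟩)
        · exact ⟨hn, by omega⟩
        · exact ⟨a, by omega⟩
    rw [this, Finset.sum_insert (by simp)]
  have e2 : ∑ m ∈ S with m < n, d m * 2^(160*m) < 2^(160*n) :=
    mask_lt _ _ (by simp) _ (fun m hm => hd m (Finset.mem_filter.1 hm).1)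
  have e3 : 2^160 * 2^(160*n) ∣ ∑ m ∈ S with n < m, d m * 2^(160*m) := by
    apply Finset.dvd_sum
    intro m hm
    rw [← pow_add]
    apply Dvd.dvd.mul_left
    apply pow_dvd_pow
    have := (Finset.mem_filter.1 hm).2
    omega
  obtain ⟨k, hk⟩ := e3
  rw [e1, hk, Nat.shiftRight_eq_div_pow]
  have : d n * 2^(160*n) + 2^160*2^(160*n)*k = (d n + 2^160*k) * 2^(160*n) := by ring
  rw [this, Nat.add_mul_div_right _ _ (by positivity), Nat.div_eq_of_lt e2, zero_add,
    Nat.add_mul_mod_self_left, Nat.mod_eq_of_lt (hd n hn)]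



theorem dig_sum' [Nonempty α] (E : Finset α) (p : α → ℕ) (hp : Set.InjOn p E) (d : α → ℕ) (hd : ∀ n ∈ E, d n < 2^160) (e : α) (he : e ∈ E) :
    (∑ n ∈ E, d n * 2^(160*p n)) >>> (160*p e) % 2^160 = d e := by
  classical
  have h := dig_sum (E.image p) (fun n => d (Function.invFunOn p E n)) (fun n hn => by
    obtain ⟨a, ha, rfl⟩ := Finset.mem_image.1 hn
    exact hd _ (by simpa using Function.invFunOn_mem (f := p) (s := (E : Set α)) ⟨a, ha, rfl⟩))
    (p e) (Finset.mem_image_of_mem p he)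
  rw [Finset.sum_image hp] at h
  have k : ∀ x ∈ E, Function.invFunOn p E (p x) = x := fun x hx => hp.leftInvOn_invFunOn hx
  simp only [k e he] at h
  rw [← h]
  congr 2
  exact Finset.sum_congr rfl fun x hx => by simp only [k x hx]

theorem land_sum [Nonempty α] (E : Finset α) (p : α → ℕ) (hp : Set.InjOn p E) (d : α → ℕ) (hd : ∀ n ∈ E, d n < 2^160) (T : Finset α) (hT : T ⊆ E)
    (κ : ℕ) (hκ : κ < 2^160) :
    (∑ e ∈ E, d e * 2^(160*p e)) &&& (κ * ∑ e ∈ T, 2^(160*p e))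
      = ∑ e ∈ T, (d e &&& κ) * 2^(160*p e) := by
  classical
  have h := land_mask (∑ e ∈ E, d e * 2^(160*p e)) κ hκ (T.image p)
  have hp' : Set.InjOn p T := hp.mono (by exact_mod_cast hT)
  rw [Finset.sum_image hp', Finset.sum_image hp'] at h
  rw [h]
  refine Finset.sum_congr rfl fun e he => ?_
  rw [dig_sum' E p hp d hd e (hT he)]

theorem sum_inj [Nonempty α] (E : Finset α) (p : α → ℕ) (hp : Set.InjOn p E) (d d' : α → ℕ) (hd : ∀ n ∈ E, d n < 2^160) (hd' : ∀ n ∈ E, d' n < 2^160)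
    (h : ∑ e ∈ E, d e * 2^(160*p e) = ∑ e ∈ E, d' e * 2^(160*p e)) (e : α) (he : e ∈ E) :
    d e = d' e := by
  rw [← dig_sum' E p hp d hd e he, h, dig_sum' E p hp d' hd' e he]
end bits
end SB

namespace SB
open MvPolynomial

def EE : Finset (Fin 4 →₀ ℕ) := Finset.univ.finsuppAntidiag 11
def pn (e : Fin 4 →₀ ℕ) : ℕ := e 1 + 12 * e 2 + 144 * e 3

theorem mem_EE {e : Fin 4 →₀ ℕ} : e ∈ EE ↔ e 0 + e 1 + e 2 + e 3 = 11 := by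
  simp [EE, Finset.mem_finsuppAntidiag, Fin.sum_univ_four]

attribute [irreducible] EE

theorem sumTo_eq (f : ℕ → ℕ) (n : ℕ) : sumTo f n = ∑ k ∈ Finset.range n, f k := by
  induction n with
  | zero => rfl
  | succ n ih => rw [Finset.sum_range_succ, ← ih]; rfl

theorem pos_eq (e : Fin 4 →₀ ℕ) : ∑ k, e k * wt k = 160 * pn e := by
  simp [Fin.sum_univ_four, wt, pn]; ring

theorem pn_inj : Set.InjOn pn EE := by
  intro e he f hf h
  have he := mem_EE.1 (Finset.mem_coe.1 he)
  have hf := mem_EE.1 (Finset.mem_coe.1 hf)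
  unfold pn at h
  have h3 : e 3 = f 3 := by omega
  have h2 : e 2 = f 2 := by omega
  ext k; fin_cases k <;> simp <;> omega

theorem univ4 : ∀ i j k l : Fin 4, i ≠ j → i ≠ k → i ≠ l → j ≠ k → j ≠ l → k ≠ l →
    (Finset.univ : Finset (Fin 4)) = {i, j, k, l} := by decide

theorem sum4 {M : Type*} [AddCommMonoid M] {i j k l : Fin 4} (hij : i ≠ j) (hik : i ≠ k) (hil : i ≠ l)
    (hjk : j ≠ k) (hjl : j ≠ l) (hkl : k ≠ l) (f : Fin 4 → M) :
    ∑ x, f x = f i + (f j + (f k + f l)) := by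
  rw [univ4 i j k l hij hik hil hjk hjl hkl, Finset.sum_insert (by simp [*]),
    Finset.sum_insert (by simp [*]), Finset.sum_insert (by simp [*]), Finset.sum_singleton]

theorem onesG_eq {i j k l : Fin 4} (hij : i ≠ j) (hik : i ≠ k) (hil : i ≠ l)
    (hjk : j ≠ k) (hjl : j ≠ l) (hkl : k ≠ l) (m : ℕ) :
    onesG (wt i) (wt j) (wt k) (wt l) m = ∑ e ∈ EE with e i = m, 2^(160 * pn e) := by
  simp only [onesG, sumTo_eq]
  rw [Finset.sum_sigma']
  have hE : ∀ e : Fin 4 →₀ ℕ, e ∈ EE ↔ e i + (e j + (e k + e l)) = 11 := by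
    intro e; rw [← sum4 hij hik hil hjk hjl hkl, mem_EE, Fin.sum_univ_four]
  have all : ∀ x : Fin 4, x = i ∨ x = j ∨ x = k ∨ x = l := by
    intro x
    have := Finset.mem_univ x
    rw [univ4 i j k l hij hik hil hjk hjl hkl] at this
    simpa using this
  let g : (Σ _ : ℕ, ℕ) → (Fin 4 →₀ ℕ) := fun q => Finsupp.single i m + Finsupp.single j q.1 +
      Finsupp.single k q.2 + Finsupp.single l (11 - m - q.1 - q.2)
  have gi : ∀ q, g q i = m := by intro q; simp [g, hij, hik, hil]
  have gj : ∀ q, g q j = q.1 := by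
    intro q; simp [g, hij.symm, hjk, hjl]
  have gk : ∀ q, g q k = q.2 := by
    intro q; simp [g, hik.symm, hjk.symm, hkl]
  have gl : ∀ q, g q l = 11 - m - q.1 - q.2 := by
    intro q; simp [g, hil, hjl, hkl, Ne.symm]
  refine Finset.sum_nbij' g (fun e => ⟨e j, e k⟩) ?_ ?_ ?_ ?_ ?_
  · rintro q hq
    simp only [Finset.mem_sigma, Finset.mem_range] at hq
    rw [Finset.mem_filter, hE, gi, gj, gk, gl]
    omega
  · intro e he
    rw [Finset.mem_filter, hE] at he
    simp only [Finset.mem_sigma, Finset.mem_range]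
    omega
  · intro q hq
    simp [gj, gk]
  · intro e he
    rw [Finset.mem_filter, hE] at he
    ext x
    rcases all x with rfl | rfl | rfl | rfl
    · rw [gi]; omega
    · rw [gj]
    · rw [gk]
    · rw [gl]; simp only; omega
  · rintro q hq
    rw [← pos_eq, sum4 hij hik hil hjk hjl hkl, gi, gj, gk, gl, Nat.pow_eq]
    congr 1; ring

theorem sum_EE {M : Type*} [AddCommMonoid M] (i : Fin 4) (f : (Fin 4 →₀ ℕ) → M) :
    ∑ m ∈ Finset.range 12, ∑ e ∈ EE with e i = m, f e = ∑ e ∈ EE, f e := by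
  apply Finset.sum_fiberwise_of_maps_to
  intro e he
  have := mem_EE.1 he
  rw [Finset.mem_range]
  fin_cases i <;> simp <;> omega

theorem onesE_eq : onesE = ∑ e ∈ EE, 2^(160 * pn e) := by
  rw [← sum_EE 0, onesE, sumTo_eq]
  refine Finset.sum_congr rfl fun m _ => ?_
  exact onesG_eq (i := 0) (j := 1) (k := 2) (l := 3) (by decide) (by decide) (by decide) (by decide)
    (by decide) (by decide) m

theorem mul_aux (n : ℕ) : Nat.mul (Nat.pow 2 159) n = 2^159 * n := by rw [Nat.mul_eq, Nat.pow_eq]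

theorem hones_eq : hones = ∑ e ∈ EE, 2^159 * 2^(160 * pn e) := by
  unfold hones; rw [mul_aux, onesE_eq, Finset.mul_sum]

attribute [local irreducible] hones onesE

theorem hor_eq (si sj sk sl Z n acc : ℕ) : hor si sj sk sl Z n acc =
    acc * (2^si+2^sj)^n + ∑ m ∈ Finset.range n,
      ((Z &&& msk si sj sk sl m) >>> (m * si)) * (2^si+2^sj)^m := by
  induction n generalizing acc with
  | zero => simp [hor]
  | succ n ih =>
    have : hor si sj sk sl Z (n+1) acc = hor si sj sk sl Z n (acc <<< si + acc <<< sj +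
      ((Z &&& msk si sj sk sl n) >>> (n * si))) := rfl
    rw [this, ih, Finset.sum_range_succ, Nat.shiftLeft_eq, Nat.shiftLeft_eq]
    ring

theorem op0_eq {i j k l : Fin 4} (hij : i ≠ j) (hik : i ≠ k) (hil : i ≠ l)
    (hjk : j ≠ k) (hjl : j ≠ l) (hkl : k ≠ l) (d : (Fin 4 →₀ ℕ) → ℕ) (hd : ∀ e ∈ EE, d e < 2^160) :
    op0 (wt i) (wt j) (wt k) (wt l) (∑ e ∈ EE, d e * 2^(160 * pn e)) =
      ∑ e ∈ EE, d e * ∏ x, (Function.update (fun x => 2^wt x) i (2^wt i + 2^wt j) x)^(e x) := by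
  unfold op0; rw [hor_eq, zero_mul, zero_add,
    ← sum_EE i (fun e => d e * ∏ x, (Function.update (fun x => 2^wt x) i (2^wt i + 2^wt j) x)^(e x))]
  refine Finset.sum_congr rfl fun m _ => ?_
  have h1 : msk (wt i) (wt j) (wt k) (wt l) m = (2^160-1) * ∑ e ∈ EE with e i = m, 2^(160*pn e) := by
    rw [← onesG_eq hij hik hil hjk hjl hkl]; unfold msk; rw [Nat.mul_eq]
  rw [h1, land_sum EE pn pn_inj d hd _ (Finset.filter_subset _ _) _ (by norm_num)]
  have h2 : ∑ e ∈ EE with e i = m, (d e &&& (2^160-1)) * 2^(160*pn e) =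
    (∑ e ∈ EE with e i = m, d e * ∏ x ∈ Finset.univ.erase i, (2^wt x)^(e x)) * 2^(m * wt i) := by
    rw [Finset.sum_mul]
    refine Finset.sum_congr rfl fun e he => ?_
    have he := Finset.mem_filter.1 he
    rw [Nat.and_two_pow_sub_one_of_lt_two_pow (hd e he.1), ← pos_eq, mul_assoc]
    congr 1
    rw [← he.2, ← Finset.prod_pow_eq_pow_sum, ← Finset.mul_prod_erase _ _ (Finset.mem_univ i), mul_comm]
    congr 1
    refine Finset.prod_congr rfl fun x _ => ?_
    rw [← pow_mul, mul_comm]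
  rw [h2, Nat.shiftRight_eq_div_pow, Nat.mul_div_cancel _ (by positivity), Finset.sum_mul]
  refine Finset.sum_congr rfl fun e he => ?_
  have he := Finset.mem_filter.1 he
  rw [mul_assoc, ← Finset.mul_prod_erase Finset.univ (fun x => (Function.update (fun x => 2^wt x) i (2^wt i + 2^wt j) x)^(e x)) (Finset.mem_univ i),
    Function.update_self, he.2, mul_comm (∏ x ∈ _, _)]
  congr 2
  refine Finset.prod_congr rfl fun x hx => ?_
  rw [Function.update_of_ne (Finset.ne_of_mem_erase hx)]

theorem card_EE : EE.card ≤ 2^9 := by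
  have hs : EE.card ≤ (Finset.sigma (Finset.range 12) fun a => Finset.sigma (Finset.range (12-a))
      fun b => Finset.range (12-a-b)).card := by
    refine Finset.card_le_card_of_injOn (fun e => ⟨e 1, e 2, e 3⟩) ?_ ?_
    · intro e he
      have := mem_EE.1 he
      simp; omega
    · intro e he f hf h
      have he := mem_EE.1 (Finset.mem_coe.1 he)
      have hf := mem_EE.1 (Finset.mem_coe.1 hf)
      simp only [Sigma.mk.injEq, heq_eq_eq] at h
      ext k; fin_cases k <;> simp <;> omega
  refine hs.trans ?_
  simp only [Finset.card_sigma, Finset.card_range]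
  decide +kernel
end SB

namespace SB
attribute [local irreducible] hones onesE
open MvPolynomial

def dom (F : MvPolynomial (Fin 4) ℤ) (n : ℕ) : Prop :=
  ∃ G : MvPolynomial (Fin 4) ℕ, (∀ e, |coeff e F| ≤ ((coeff e G : ℕ) : ℤ)) ∧ eval (fun _ => 1) G ≤ n

theorem dom.coeff_le {F : MvPolynomial (Fin 4) ℤ} {n : ℕ} (h : dom F n) (e) : |coeff e F| ≤ n := by
  obtain ⟨G, h1, h2⟩ := h
  refine (h1 e).trans ?_
  norm_cast
  refine le_trans ?_ h2
  rw [eval_eq']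
  by_cases he : e ∈ G.support
  · have := Finset.single_le_sum (f := fun d => coeff d G * ∏ i : Fin 4, 1 ^ d i) (fun d _ => Nat.zero_le _) he
    simpa using this
  · rw [notMem_support_iff.1 he]; exact Nat.zero_le _

theorem dom.mono {F : MvPolynomial (Fin 4) ℤ} {n m : ℕ} (h : dom F n) (hm : n ≤ m) : dom F m := by
  obtain ⟨G, h1, h2⟩ := h
  exact ⟨G, h1, h2.trans hm⟩

theorem dom.add {F F' : MvPolynomial (Fin 4) ℤ} {n m : ℕ} (h : dom F n) (h' : dom F' m) :
    dom (F + F') (n + m) := by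
  obtain ⟨G, h1, h2⟩ := h
  obtain ⟨G', h1', h2'⟩ := h'
  refine ⟨G + G', fun e => ?_, ?_⟩
  · rw [coeff_add, coeff_add]; push_cast
    exact (abs_add_le _ _).trans (add_le_add (h1 e) (h1' e))
  · rw [map_add]; exact add_le_add h2 h2'

theorem dom.neg {F : MvPolynomial (Fin 4) ℤ} {n : ℕ} (h : dom F n) : dom (-F) n := by
  obtain ⟨G, h1, h2⟩ := h
  refine ⟨G, fun e => ?_, h2⟩
  rw [coeff_neg, abs_neg]; exact h1 e

theorem dom.sub {F F' : MvPolynomial (Fin 4) ℤ} {n m : ℕ} (h : dom F n) (h' : dom F' m) :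
    dom (F - F') (n + m) := by
  rw [sub_eq_add_neg]; exact h.add h'.neg

theorem dom.mul {F F' : MvPolynomial (Fin 4) ℤ} {n m : ℕ} (h : dom F n) (h' : dom F' m) :
    dom (F * F') (n * m) := by
  obtain ⟨G, h1, h2⟩ := h
  obtain ⟨G', h1', h2'⟩ := h'
  refine ⟨G * G', fun e => ?_, ?_⟩
  · rw [coeff_mul, coeff_mul]; push_cast
    refine (Finset.abs_sum_le_sum_abs _ _).trans (Finset.sum_le_sum fun x _ => ?_)
    rw [abs_mul]
    exact mul_le_mul (h1 _) (h1' _) (abs_nonneg _) (by positivity)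
  · rw [map_mul]; exact mul_le_mul' h2 h2'

theorem dom_C (a : ℤ) : dom (C a) a.natAbs := by
  refine ⟨C a.natAbs, fun e => ?_, by simp⟩
  rw [coeff_C, coeff_C]; split_ifs <;> simp

theorem dom_zero : dom 0 0 := by simpa using dom_C 0
theorem dom_one : dom 1 1 := by simpa using dom_C 1

theorem dom_X (i : Fin 4) : dom (X i) 1 := by
  refine ⟨X i, fun e => ?_, by simp⟩
  rw [coeff_X, coeff_X]; split_ifs <;> simp

theorem dom.pow {F : MvPolynomial (Fin 4) ℤ} {n : ℕ} (h : dom F n) (k : ℕ) : dom (F ^ k) (n ^ k) := by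
  induction k with
  | zero => simpa using dom_one
  | succ k ih => rw [pow_succ, pow_succ]; exact ih.mul h

theorem dom_sum {α : Type*} (s : Finset α) (F : α → MvPolynomial (Fin 4) ℤ) (n : ℕ)
    (h : ∀ a ∈ s, dom (F a) n) : dom (∑ a ∈ s, F a) (s.card * n) := by
  classical
  induction s using Finset.induction_on with
  | empty => simpa using dom_zero
  | insert a s ha ih =>
    rw [Finset.sum_insert ha, Finset.card_insert_of_notMem ha, add_mul, one_mul, add_comm _ n]
    exact (h a (by simp)).add (ih fun b hb => h b (by simp [hb]))

theorem aeval_EE {A : Type*} [CommRing A] [Algebra ℤ A] {F : MvPolynomial (Fin 4) ℤ} (hF : F.IsHomogeneous 11)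
    (x : Fin 4 → A) : aeval x F = ∑ e ∈ EE, ((coeff e F : ℤ) : A) * ∏ k, x k ^ e k := by
  rw [aeval_def, eval₂_eq']
  simp only [eq_intCast]
  refine Finset.sum_subset ?_ ?_
  · intro e he
    rw [mem_support_iff] at he
    have := hF he
    rw [mem_EE]
    simpa [Finsupp.weight_apply, Finsupp.sum_fintype, Fin.sum_univ_four] using this
  · intro e _ he
    rw [notMem_support_iff.1 he]; simp

def Inv (Z : ℕ) (F : MvPolynomial (Fin 4) ℤ) : Prop :=
  F.IsHomogeneous 11 ∧ (∀ e, |coeff e F| ≤ 2^158) ∧ (Z : ℤ) = hones + aeval XX F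

theorem XX_pow (e : Fin 4 →₀ ℕ) : ∏ k, XX k ^ e k = 2^(160 * pn e) := by
  rw [← pos_eq, ← Finset.prod_pow_eq_pow_sum]
  refine Finset.prod_congr rfl fun k _ => ?_
  have : XX k = 2^wt k := by simp [XX]
  rw [this, ← pow_mul, mul_comm]

theorem hones_int : (hones : ℤ) = ∑ e ∈ EE, 2^159 * 2^(160 * pn e) := by
  rw [hones_eq]; push_cast; rfl

theorem val_eq {F : MvPolynomial (Fin 4) ℤ} (hF : F.IsHomogeneous 11) :
    (hones : ℤ) + aeval XX F = ∑ e ∈ EE, (coeff e F + 2^159) * 2^(160 * pn e) := by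
  rw [aeval_EE hF, hones_int, ← Finset.sum_add_distrib]
  refine Finset.sum_congr rfl fun e _ => ?_
  rw [XX_pow, Int.cast_id]; ring

theorem val_nonneg {F : MvPolynomial (Fin 4) ℤ} (hF : F.IsHomogeneous 11)
    (hb : ∀ e, |coeff e F| ≤ 2^158) : 0 ≤ (hones : ℤ) + aeval XX F := by
  rw [val_eq hF]
  refine Finset.sum_nonneg fun e _ => mul_nonneg ?_ (by positivity)
  have := abs_le.1 (hb e)
  norm_num at this ⊢; linarith

theorem Inv.digits {Z : ℕ} {F : MvPolynomial (Fin 4) ℤ} (h : Inv Z F) :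
    ∃ d : (Fin 4 →₀ ℕ) → ℕ, (∀ e, (d e : ℤ) = coeff e F + 2^159) ∧ (∀ e, d e ≤ 2^159+2^158) ∧
      Z = ∑ e ∈ EE, d e * 2^(160 * pn e) := by
  obtain ⟨h1, h2, h3⟩ := h
  have h4 : ∀ e, ((coeff e F + 2^159).toNat : ℤ) = coeff e F + 2^159 := by
    intro e
    have := abs_le.1 (h2 e)
    rw [Int.toNat_of_nonneg]
    norm_num at this ⊢; linarith
  refine ⟨fun e => (coeff e F + 2^159).toNat, h4, fun e => ?_, ?_⟩
  · have := abs_le.1 (h2 e)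
    have := h4 e
    zify; rw [h4]; linarith
  · zify
    rw [h3, val_eq h1]
    refine Finset.sum_congr rfl fun e _ => ?_
    rw [h4]

theorem ltest_sound {Z : ℕ} {F : MvPolynomial (Fin 4) ℤ} (h : Inv Z F) (ht : ltest Z = true) (e)
    (he : e ∈ EE) : 0 ≤ coeff e F := by
  obtain ⟨d, h1, h2, h3⟩ := h.digits
  have ht : Z &&& hones = hones := Nat.eq_of_beq_eq_true ht
  have hd : ∀ e ∈ EE, d e < 2^160 := fun e _ => by have := h2 e; omega
  have h5 := land_sum EE pn pn_inj d hd EE (Finset.Subset.refl _) (2^159) (by norm_num)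
  rw [Finset.mul_sum, ← hones_eq, ← h3, ht, hones_eq] at h5
  have h6 := sum_inj EE pn pn_inj _ _ (fun _ _ => by norm_num)
    (fun e _ => lt_of_le_of_lt Nat.and_le_right (by norm_num)) h5 e he
  have h7 : 2^159 ≤ d e := by rw [h6]; exact Nat.and_le_left
  have := h1 e
  zify at h7
  linarith

theorem bit_aux (x : ℕ) (h : x &&& (2^160 - 2^139) = 2^159) (hx : x < 2^160) : 2^159 ≤ x ∧ x < 2^159 + 2^139 := by
  have h1 := land_shift x (2^21-1) 139 (by norm_num)
  rw [show (2^21-1) <<< 139 = 2^160-2^139 by decide, h, Nat.and_two_pow_sub_one_eq_mod,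
    Nat.shiftRight_eq_div_pow, Nat.shiftLeft_eq] at h1
  have h2 : x / 2^139 < 2^21 := by omega
  rw [Nat.mod_eq_of_lt (a := x / 2^139) (by omega), Nat.mod_eq_of_lt h2] at h1
  omega

theorem gtest_sound {Z : ℕ} {F : MvPolynomial (Fin 4) ℤ} (h : Inv Z F) (ht : gtest Z = true) (e) :
    |coeff e F| ≤ 2^138 := by
  by_cases he : e ∈ EE
  swap
  · have : coeff e F = 0 := by
      by_contra h0
      have := h.1 h0
      rw [mem_EE] at he
      exact he (by simpa [Finsupp.weight_apply, Finsupp.sum_fintype, Fin.sum_univ_four] using this)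
    rw [this]; norm_num
  obtain ⟨d, h1, h2, h3⟩ := h.digits
  have ht : (Z + gones) &&& kones = hones := Nat.eq_of_beq_eq_true ht
  have hd : ∀ e ∈ EE, d e + 2^138 < 2^160 := fun e _ => by have := h2 e; omega
  have h5 := land_sum EE pn pn_inj (fun e => d e + 2^138) hd EE (Finset.Subset.refl _)
    (2^160-2^139) (by norm_num)
  have h4 : Z + gones = ∑ e ∈ EE, (d e + 2^138) * 2^(160 * pn e) := by
    have : gones = 2^138 * onesE := by unfold gones; rw [Nat.mul_eq, Nat.pow_eq]
    rw [h3, this, onesE_eq, Finset.mul_sum, ← Finset.sum_add_distrib]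
    refine Finset.sum_congr rfl fun e _ => by ring
  have h4' : kones = (2^160-2^139) * ∑ e ∈ EE, 2^(160 * pn e) := by
    rw [← onesE_eq]; unfold kones; rw [Nat.mul_eq]
  rw [← h4, ← h4', ht, hones_eq] at h5
  have h6 := sum_inj EE pn pn_inj _ _ (fun _ _ => by norm_num)
    (fun e he => lt_of_le_of_lt Nat.and_le_left (hd e he)) h5 e he
  obtain ⟨h7, h8⟩ := bit_aux _ h6.symm (hd e he)
  have := h1 e
  zify at h7 h8
  rw [abs_le]
  constructor <;> linarith

noncomputable def sub (i j : Fin 4) (F : MvPolynomial (Fin 4) ℤ) : MvPolynomial (Fin 4) ℤ :=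
  aeval (Function.update X i (X i + X j)) F

theorem aeval_sub {A : Type*} [CommRing A] [Algebra ℤ A] (i j : Fin 4) (F : MvPolynomial (Fin 4) ℤ) (x : Fin 4 → A) :
    aeval x (sub i j F) = aeval (Function.update x i (x i + x j)) F := by
  unfold sub
  rw [← AlgHom.comp_apply, comp_aeval]
  congr 2
  ext k
  by_cases hk : k = i
  · subst hk; simp
  · simp [Function.update_of_ne hk]

theorem sub_hom {i j : Fin 4} {F : MvPolynomial (Fin 4) ℤ} (hF : F.IsHomogeneous 11) :
    (sub i j F).IsHomogeneous 11 := by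
  have := hF.aeval (n := 1) (Function.update X i (X i + X j) : Fin 4 → MvPolynomial (Fin 4) ℤ) ?_
  · simpa [sub] using this
  intro k
  by_cases hk : k = i
  · subst hk; simp only [Function.update_self]; exact (isHomogeneous_X _ _).add (isHomogeneous_X _ _)
  · rw [Function.update_of_ne hk]; exact isHomogeneous_X _ _

theorem sub_dom {i j : Fin 4} {F : MvPolynomial (Fin 4) ℤ} (hF : F.IsHomogeneous 11)
    (hb : ∀ e, |coeff e F| ≤ 2^138) (e) : |coeff e (sub i j F)| ≤ 2^158 := by
  have : dom (sub i j F) (EE.card * (2^138 * 2^11)) := by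
    unfold sub
    rw [aeval_EE hF]
    refine dom_sum _ _ _ fun e he => ?_
    have hc : dom ((coeff e F : ℤ) : MvPolynomial (Fin 4) ℤ) (2^138) := by
      have := dom_C (coeff e F)
      rw [show (C (coeff e F) : MvPolynomial (Fin 4) ℤ) = ((coeff e F : ℤ) : MvPolynomial (Fin 4) ℤ) by simp] at this
      refine this.mono ?_
      have := hb e
      zify; exact this
    refine hc.mul ?_
    have hY : ∀ k, dom ((Function.update X i (X i + X j) : Fin 4 → MvPolynomial (Fin 4) ℤ) k) 2 := by
      intro k
      by_cases hk : k = i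
      · subst hk; rw [Function.update_self]; exact (dom_X _).add (dom_X _)
      · rw [Function.update_of_ne hk]; exact (dom_X _).mono (by norm_num)
    rw [Fin.prod_univ_four]
    refine ((((hY 0).pow _).mul ((hY 1).pow _)).mul ((hY 2).pow _)).mul ((hY 3).pow _) |>.mono ?_
    rw [← pow_add, ← pow_add, ← pow_add, mem_EE.1 he]
  refine (this.coeff_le e).trans ?_
  have h9 : EE.card * (2^138*2^11) ≤ 2^9 * (2^138*2^11) := Nat.mul_le_mul_right _ card_EE
  have h9 := Int.ofNat_le.2 h9
  refine h9.trans ?_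
  rw [show (2:ℕ)^9 * (2^138*2^11) = 2^158 by rw [← pow_add, ← pow_add]]
  exact le_of_eq (by push_cast)

theorem hones_lt_aux (a b : ℕ) (v : ℤ) (h : (a : ℤ) - b = v) (hv : 0 ≤ v) : ((Nat.sub a b : ℕ) : ℤ) = v := by
  change ((a - b : ℕ) : ℤ) = v
  omega

theorem op_sound {i j k l : Fin 4} (hij : i ≠ j) (hik : i ≠ k) (hil : i ≠ l)
    (hjk : j ≠ k) (hjl : j ≠ l) (hkl : k ≠ l) {Z : ℕ} {F : MvPolynomial (Fin 4) ℤ} (h : Inv Z F)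
    (ht : gtest Z = true) : Inv (op (wt i) (wt j) (wt k) (wt l) Z) (sub i j F) := by
  have hb := gtest_sound h ht
  have h1 := sub_hom (i := i) (j := j) h.1
  have h2 := sub_dom (i := i) (j := j) h.1 hb
  refine ⟨h1, h2, ?_⟩
  obtain ⟨d, d1, d2, d3⟩ := h.digits
  unfold op
  refine hones_lt_aux _ _ _ ?_ (val_nonneg h1 h2)
  rw [Nat.add_eq, d3]
  have e1 := op0_eq hij hik hil hjk hjl hkl d (fun e _ => by have := d2 e; omega)
  have e2 := op0_eq hij hik hil hjk hjl hkl (fun _ => 2^159) (fun e _ => by norm_num)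
  rw [← hones_eq] at e2
  rw [e1, e2, aeval_sub, aeval_EE h.1]
  push_cast
  have : ∀ e : Fin 4 →₀ ℕ, (((∏ x, (Function.update (fun x => 2^wt x) i (2^wt i + 2^wt j) x)^(e x) : ℕ)) : ℤ)
      = ∏ k, Function.update XX i (XX i + XX j) k ^ e k := by
    intro e
    rw [Nat.cast_prod]
    refine Finset.prod_congr rfl fun k _ => ?_
    rw [Nat.cast_pow]
    congr 1
    by_cases hk : k = i
    · subst hk; simp [XX]
    · simp [Function.update_of_ne hk, XX]
  push_cast at this
  simp only [this]
  rw [add_comm, add_sub_assoc, ← Finset.sum_sub_distrib]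
  congr 1
  refine Finset.sum_congr rfl fun e _ => ?_
  rw [d1]; push_cast; ring

theorem run_sound (fuel : ℕ) : ∀ (code : ℕ) (st : List (ℕ × ℕ)), run fuel code st = true →
    ∀ s ∈ st, ∀ F G, Inv s.1 F → (s.2 ≠ 0 → Inv s.2 G) → ∀ x : Fin 4 → ℝ, (∀ i, 0 ≤ x i) →
      (s.2 ≠ 0 → aeval x G ≤ 0) → 0 ≤ aeval x F := by
  induction fuel with
  | zero => intro code st h; exact absurd h (by simp [run])
  | succ n ih =>
    intro code st h
    rcases st with _ | ⟨⟨P, N⟩, st⟩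
    · simp
    change stepL (run n) code P N st = true at h
    unfold stepL at h
    intro s hs F G hF hG x hx hx2
    rcases h0 : Nat.beq (Nat.mod code 16) 0 with _ | _
    · rcases h7 : Nat.beq (Nat.mod code 16) 7 with _ | _
      · -- split
        simp only [h0, h7, Bool.and_eq_true, Bool.or_eq_true] at h
        obtain ⟨hP, hN, h⟩ := h
        have key : ∀ i j k l : Fin 4, i ≠ j → i ≠ k → i ≠ l → j ≠ k → j ≠ l → k ≠ l →
            run n (Nat.div code 16) ((op (wt i) (wt j) (wt k) (wt l) P, opN (wt i) (wt j) (wt k) (wt l) N) ::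
            (op (wt j) (wt i) (wt k) (wt l) P, opN (wt j) (wt i) (wt k) (wt l) N) :: st) = true →
            0 ≤ aeval x F := by
          intro i j k l hij hik hil hjk hjl hkl hr
          have ih := ih _ _ hr
          rcases List.mem_cons.1 hs with rfl | hs
          swap
          · exact ih s (by simp [hs]) F G hF hG x hx hx2
          have half : ∀ i j k l : Fin 4, i ≠ j → i ≠ k → i ≠ l → j ≠ k → j ≠ l → k ≠ l → x j ≤ x i →
             (∀ F G, Inv (op (wt i) (wt j) (wt k) (wt l) P) F → (opN (wt i) (wt j) (wt k) (wt l) N ≠ 0 →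
               Inv (opN (wt i) (wt j) (wt k) (wt l) N) G) → ∀ x : Fin 4 → ℝ, (∀ i, 0 ≤ x i) →
               (opN (wt i) (wt j) (wt k) (wt l) N ≠ 0 → aeval x G ≤ 0) → 0 ≤ aeval x F) →
             0 ≤ aeval x F := by
            intro i j k l hij hik hil hjk hjl hkl hle hcl
            have hup : Function.update (Function.update x i (x i - x j)) i
                ((Function.update x i (x i - x j)) i + (Function.update x i (x i - x j)) j) = x := by
              rw [Function.update_self, Function.update_of_ne hij.symm, sub_add_cancel,
                Function.update_idem, Function.update_eq_self]
            have hN0 : opN (wt i) (wt j) (wt k) (wt l) N ≠ 0 → N ≠ 0 ∧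
                opN (wt i) (wt j) (wt k) (wt l) N = op (wt i) (wt j) (wt k) (wt l) N := by
              intro hne
              rcases N with _ | N
              · exact absurd rfl hne
              · exact ⟨by simp, rfl⟩
            have := hcl (sub i j F) (sub i j G) (op_sound hij hik hil hjk hjl hkl hF hP) (fun hne => by
              obtain ⟨h1, h2⟩ := hN0 hne
              rw [h2]
              exact op_sound hij hik hil hjk hjl hkl (hG h1)
                (hN.resolve_left fun hh => h1 (Nat.eq_of_beq_eq_true hh)))
              (Function.update x i (x i - x j)) (fun k => by
                by_cases hk : k = i
                · subst hk; rw [Function.update_self]; linarith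
                · rw [Function.update_of_ne hk]; exact hx k) (fun hne => by
                rw [aeval_sub, hup]; exact hx2 (hN0 hne).1)
            rwa [aeval_sub, hup] at this
          rcases le_total (x j) (x i) with hle | hle
          · exact half i j k l hij hik hil hjk hjl hkl hle (fun F G => ih (_, _) (List.mem_cons_self) F G)
          · exact half j i k l hij.symm hjk hjl hik hil hkl hle (fun F G => ih (_, _) (List.mem_cons_of_mem _ List.mem_cons_self) F G)
        unfold tsel at h
        split at h
        · exact key 0 1 2 3 (by decide) (by decide) (by decide) (by decide) (by decide) (by decide) h
        · exact key 0 2 1 3 (by decide) (by decide) (by decide) (by decide) (by decide) (by decide) h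
        · exact key 0 3 1 2 (by decide) (by decide) (by decide) (by decide) (by decide) (by decide) h
        · exact key 1 2 0 3 (by decide) (by decide) (by decide) (by decide) (by decide) (by decide) h
        · exact key 1 3 0 2 (by decide) (by decide) (by decide) (by decide) (by decide) (by decide) h
        · exact key 2 3 0 1 (by decide) (by decide) (by decide) (by decide) (by decide) (by decide) h
        · exact absurd h (by simp)
      · -- commit
        simp only [h0, h7, Bool.and_eq_true] at h
        obtain ⟨⟨hP, hN⟩, h⟩ := h
        have ih := ih _ _ h
        rcases List.mem_cons.1 hs with rfl | hs
        swap
        · exact ih s (by simp [hs]) F G hF hG x hx hx2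
        have hN0 : N ≠ 0 := by
          rintro rfl
          exact absurd hN (by decide +kernel)
        set κ : ℕ := Nat.mod (Nat.div code 16) (2^16) with hκ
        have hκ2 : κ < 2^16 := Nat.mod_lt _ (by norm_num)
        have hGI := hG hN0
        have i1 : (F + C (κ : ℤ) * G).IsHomogeneous 11 := by
          refine hF.1.add ?_
          simpa using (isHomogeneous_C (Fin 4) (κ : ℤ)).mul hGI.1
        have i2 : ∀ e, |coeff e (F + C (κ : ℤ) * G)| ≤ 2^158 := by
          intro e
          rw [coeff_add, coeff_C_mul]
          have a1 := gtest_sound hF hP e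
          have a2 := gtest_sound hGI hN e
          refine (abs_add_le _ _).trans ?_
          rw [abs_mul, Nat.abs_cast]
          have a3 : (κ : ℤ) * |coeff e G| ≤ 2^16 * 2^138 :=
            mul_le_mul (by exact_mod_cast hκ2.le) a2 (abs_nonneg _) (by positivity)
          norm_num at a1 a3 ⊢
          linarith
        have hI : Inv (kcom code P N) (F + C (κ : ℤ) * G) := by
          refine ⟨i1, i2, ?_⟩
          unfold kcom
          refine hones_lt_aux _ _ _ ?_ (val_nonneg i1 i2)
          rw [← hκ, Nat.add_eq, Nat.mul_eq, Nat.mul_eq]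
          push_cast
          have b1 := hF.2.2
          have b2 := hGI.2.2
          simp only at b1 b2
          rw [b1, b2, map_add, map_mul]
          simp
          ring
        have := ih (kcom code P N, 0) List.mem_cons_self (F + C (κ : ℤ) * G) 0 hI (by simp) x hx (by simp)
        have hg := hx2 hN0
        rw [map_add, map_mul] at this
        simp at this
        have : 0 ≤ -((κ : ℝ) * aeval x G) := by
          rw [← mul_neg]; exact mul_nonneg (by positivity) (by linarith)
        linarith
    · -- leaf
      simp only [h0, Bool.and_eq_true] at h
      obtain ⟨hP, h⟩ := h
      rcases List.mem_cons.1 hs with rfl | hs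
      · rw [aeval_EE hF.1]
        refine Finset.sum_nonneg fun e he => mul_nonneg ?_ (Finset.prod_nonneg fun k _ => pow_nonneg (hx k) _)
        exact_mod_cast ltest_sound hF hP e he
      · exact ih _ _ h s hs F G hF hG x hx hx2
end SB

namespace SB
attribute [local irreducible] hones onesE ZH ZF ZM run
open MvPolynomial

section nat
variable {A B : Type} [CommRing A] [CommRing B] (f : A →+* B)
theorem map_mono (i : ℕ) (t z : A) : f (mono i t z) = mono i (f t) (f z) := by simp [mono]
theorem herP_succ (k : ℕ) (t z : A) : herP (k+1) t z = ((herP k t z).2,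
  (((4*k+1 : ℕ) : A)*t - z) * (herP k t z).2 - ((2*k*(2*k-1) : ℕ) : A)*t^2 * (herP k t z).1) := rfl
theorem map_herP (i : ℕ) (t z : A) : (f (herP i t z).1, f (herP i t z).2) = herP i (f t) (f z) := by
  induction i with
  | zero => simp [herP]
  | succ k ih =>
    rw [herP_succ, herP_succ, ← ih]
    simp only [map_sub, map_mul, map_natCast, map_pow]
theorem map_her (i : ℕ) (t z : A) : f (her i t z) = her i (f t) (f z) := by
  unfold her; rw [← map_herP]
theorem map_term (E : ℕ → A → A → A) (E' : ℕ → B → B → B) (hE : ∀ i t z, f (E i t z) = E' i (f t) (f z))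
    (t a b c : A) (i j k : ℕ) : f (term E t a b c i j k) = term E' (f t) (f a) (f b) (f c) i j k := by
  simp only [term, map_mul, map_add, map_pow, hE]
theorem formL_cons (E : ℕ → A → A → A) (t a b c : A) (q) (L : List (ℕ × ℕ × ℕ × ℤ)) :
    formL E t a b c (q :: L) = formL E t a b c L + (q.2.2.2 : A) * term E t a b c q.1 q.2.1 q.2.2.1 := rfl
theorem map_formL (E : ℕ → A → A → A) (E' : ℕ → B → B → B) (hE : ∀ i t z, f (E i t z) = E' i (f t) (f z))
    (t a b c : A) (L) : f (formL E t a b c L) = formL E' (f t) (f a) (f b) (f c) L := by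
  induction L with
  | nil => exact map_zero f
  | cons q L ih => rw [formL_cons, formL_cons, map_add, map_mul, map_intCast, ih, map_term f E E' hE]
theorem mfL_cons (t a : A) (m : ℤ) (L : List ℤ) (n : ℕ) :
    mfL t a (m :: L) n = (m : A) * t ^ n + a * mfL t a L (n - 1) := rfl
theorem map_mfL (t a : A) (L : List ℤ) (n : ℕ) : f (mfL t a L n) = mfL (f t) (f a) L n := by
  induction L generalizing n with
  | nil => exact map_zero f
  | cons q L ih => rw [mfL_cons, mfL_cons, map_add, map_mul, map_mul, map_intCast, ih, map_pow]
theorem map_mform (t a b c : A) : f (mform t a b c) = mform (f t) (f a) (f b) (f c) := by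
  simp only [mform, map_mul, map_sub, map_pow, map_add, map_mfL, map_ofNat]
theorem map_rootH (x : Fin 4 → A) : f (rootH x) = rootH (fun i => f (x i)) := by
  unfold rootH form
  rw [map_formL f mono mono (map_mono f)]
  simp only [map_mul, map_add, map_ofNat]
theorem map_rootF (x : Fin 4 → A) : f (rootF x) = rootF (fun i => f (x i)) := by
  unfold rootF form
  rw [map_neg, map_formL f her her (map_her f)]
  simp only [map_mul, map_add, map_ofNat]
theorem map_rootN (x : Fin 4 → A) : f (rootN x) = rootN (fun i => f (x i)) := by
  unfold rootN
  rw [map_mform]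
  simp only [map_mul, map_add, map_ofNat]
theorem term_symm1 (E : ℕ → A → A → A) (t a b c : A) (i j k : ℕ) :
    term E t a b c i j k = term E t b a c i j k := by unfold term; ring
theorem term_symm2 (E : ℕ → A → A → A) (t a b c : A) (i j k : ℕ) :
    term E t a b c i j k = term E t a c b i j k := by unfold term; ring
theorem form_symm1 (E : ℕ → A → A → A) (t a b c : A) : form E t a b c = form E t b a c := by
  unfold form
  induction qdata with
  | nil => rfl
  | cons q L ih => rw [formL_cons, formL_cons, ih, term_symm1]
theorem form_symm2 (E : ℕ → A → A → A) (t a b c : A) : form E t a b c = form E t a c b := by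
  unfold form
  induction qdata with
  | nil => rfl
  | cons q L ih => rw [formL_cons, formL_cons, ih, term_symm2]
theorem mform_symm1 (t a b c : A) : mform t a b c = mform t b a c := by unfold mform; ring
theorem mform_symm2 (t a b c : A) : mform t a b c = mform t a c b := by unfold mform; ring
end nat

abbrev MP := MvPolynomial (Fin 4) ℤ
def HB (F : MP) (d n : ℕ) : Prop := F.IsHomogeneous d ∧ dom F n
theorem HB.add {F G : MP} {d n m : ℕ} (h : HB F d n) (h' : HB G d m) : HB (F+G) d (n+m) :=
  ⟨h.1.add h'.1, h.2.add h'.2⟩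
theorem HB.sub {F G : MP} {d n m : ℕ} (h : HB F d n) (h' : HB G d m) : HB (F-G) d (n+m) :=
  ⟨h.1.sub h'.1, h.2.sub h'.2⟩
theorem HB.mul {F G : MP} {d e n m : ℕ} (h : HB F d n) (h' : HB G e m) : HB (F*G) (d+e) (n*m) :=
  ⟨h.1.mul h'.1, h.2.mul h'.2⟩
theorem HB.pow {F : MP} {d n : ℕ} (h : HB F d n) (k : ℕ) : HB (F^k) (d*k) (n^k) :=
  ⟨h.1.pow k, h.2.pow k⟩
theorem HB.mono {F : MP} {d n m : ℕ} (h : HB F d n) (hm : n ≤ m) : HB F d m := ⟨h.1, h.2.mono hm⟩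
theorem HB.cast {F : MP} {d e n : ℕ} (h : HB F d n) (hm : d = e) : HB F e n := hm ▸ h
theorem HB_zero (d : ℕ) : HB 0 d 0 := ⟨isHomogeneous_zero _ _ _, dom_zero⟩
theorem HB_X (i : Fin 4) : HB (X i) 1 1 := ⟨isHomogeneous_X _ _, dom_X i⟩
theorem HB_int (a : ℤ) : HB (a : MP) 0 a.natAbs := by
  rw [show (a : MP) = C a by simp]; exact ⟨isHomogeneous_C _ _, dom_C a⟩
theorem HB_nat (a : ℕ) : HB (a : MP) 0 a := by simpa using HB_int a
theorem HB_one : HB 1 0 1 := by simpa using HB_nat 1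
theorem HB.smul {F : MP} {d n : ℕ} (h : HB F d n) (a : ℕ) : HB (a * F) d (a * n) :=
  ((HB_nat a).mul h).cast (by simp)
theorem HB.ismul {F : MP} {d n : ℕ} (h : HB F d n) (a : ℤ) : HB (a * F) d (a.natAbs * n) :=
  ((HB_int a).mul h).cast (by simp)

def herB (i : ℕ) : ℕ × ℕ :=
  Nat.rec (motive := fun _ => ℕ × ℕ) (0, 1)
    (fun k p => (p.2, (4*k+1+30) * p.2 + 2*k*(2*k-1) * p.1)) i

theorem HB_herP {t z : MP} (ht : HB t 1 1) (hz : HB z 1 30) (i : ℕ) :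
    HB (t^2 * (herP i t z).1) (i+1) (herB i).1 ∧ HB (herP i t z).2 i (herB i).2 := by
  induction i with
  | zero =>
    constructor
    · simpa [herP, herB] using HB_zero 1
    · exact HB_one
  | succ k ih =>
    rw [herP_succ]
    constructor
    · exact (((ht.pow 2).mul ih.2).cast (by ring)).mono (by simp [herB])
    · have h1 := ((ht.smul (4*k+1)).sub hz).mul ih.2
      have h2 := ih.1.smul (2*k*(2*k-1))
      rw [← mul_assoc] at h2
      refine ((h1.cast (add_comm _ _)).sub h2).mono ?_
      simp [herB]

theorem HB_term {E : ℕ → MP → MP → MP} {w : ℕ → ℕ} {t a b c : MP} (ht : HB t 1 1)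
    (ha : ∀ i, HB (E i t a) i (w i)) (hb : ∀ i, HB (E i t b) i (w i)) (hc : ∀ i, HB (E i t c) i (w i))
    (i j k : ℕ) (h : i + j + k ≤ 11) : HB (term E t a b c i j k) 11 (6 * w i * w j * w k) := by
  unfold term
  have e : i + (j + k) = i + (k + j) := by omega
  have h2 := ((ha i).mul (((hb j).mul (hc k)).add ((hc j).mul (hb k)))).add
    ((hb i).mul (((ha j).mul (hc k)).add ((hc j).mul (ha k))))
  have h3 := h2.add ((hc i).mul (((hb j).mul (ha k)).add ((ha j).mul (hb k))))
  refine (((ht.pow (11 - i - j - k)).mul h3).cast (by omega)).mono (le_of_eq ?_)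
  simp; ring

def formB (w : ℕ → ℕ) : List (ℕ × ℕ × ℕ × ℤ) → ℕ
  | [] => 0
  | q :: L => formB w L + q.2.2.2.natAbs * (6 * w q.1 * w q.2.1 * w q.2.2.1)

theorem HB_formL {E : ℕ → MP → MP → MP} {w : ℕ → ℕ} {t a b c : MP} (ht : HB t 1 1)
    (ha : ∀ i, HB (E i t a) i (w i)) (hb : ∀ i, HB (E i t b) i (w i)) (hc : ∀ i, HB (E i t c) i (w i))
    (L) (hL : ∀ q ∈ L, q.1 + q.2.1 + q.2.2.1 ≤ 11) : HB (formL E t a b c L) 11 (formB w L) := by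
  induction L with
  | nil => exact HB_zero 11
  | cons q L ih =>
    rw [formL_cons]
    exact (ih fun q hq => hL q (by simp [hq])).add ((HB_term ht ha hb hc _ _ _ (hL q (by simp))).ismul _)

def mfB : List ℤ → ℕ
  | [] => 0
  | m :: L => m.natAbs + 30 * mfB L

theorem HB_mfL {t a : MP} (ht : HB t 1 1) (ha : HB a 1 30) (L : List ℤ) (n : ℕ) (hn : L.length ≤ n + 1) :
    HB (mfL t a L n) n (mfB L) := by
  induction L generalizing n with
  | nil => exact HB_zero n
  | cons m L ih =>
    rw [mfL_cons]
    have h1 : HB ((m : MP) * t ^ n) n m.natAbs := ((ht.pow n).cast (one_mul n)).ismul m |>.mono (by simp)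
    refine h1.add ?_
    rcases n with _ | n
    · have : L = [] := by
        cases L with
        | nil => rfl
        | cons _ _ => simp at hn
      subst this
      show HB (a * 0) 0 (30 * 0)
      rw [mul_zero]; exact HB_zero 0
    · exact (ha.mul (ih n (by simpa using hn))).cast (by omega)

theorem args : HB (X 0 : MP) 1 1 ∧ HB (10 * (X 1 + X 2 + X 3) : MP) 1 30 ∧
    HB (10 * (X 2 + X 3) : MP) 1 30 ∧ HB (10 * X 3 : MP) 1 30 := by
  have h := fun {F : MP} {d n : ℕ} (hF : HB F d n) => hF.smul 10
  refine ⟨HB_X 0, ?_, ?_, ?_⟩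
  · simpa using h (((HB_X 1).add (HB_X 2)).add (HB_X 3))
  · simpa using (h ((HB_X 2).add (HB_X 3))).mono (by norm_num : _ ≤ 30)
  · simpa using (h (HB_X 3)).mono (by norm_num : _ ≤ 30)

theorem qdeg : ∀ q ∈ qdata, q.1 + q.2.1 + q.2.2.1 ≤ 11 := by decide +kernel

theorem HB_rootH : HB (rootH (X : Fin 4 → MP)) 11 (2^158) := by
  obtain ⟨h0, h1, h2, h3⟩ := args
  have hE : ∀ {z : MP}, HB z 1 30 → ∀ i, HB (mono i (X 0) z) i (30^i) := fun hz i =>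
    (hz.pow i).cast (one_mul i)
  exact (HB_formL (w := fun i => 30^i) h0 (hE h1) (hE h2) (hE h3) qdata qdeg).mono (by decide +kernel)

theorem HB_rootF : HB (rootF (X : Fin 4 → MP)) 11 (2^158) := by
  obtain ⟨h0, h1, h2, h3⟩ := args
  have hE : ∀ {z : MP}, HB z 1 30 → ∀ i, HB (her i (X 0) z) i (herB i).2 := fun hz i =>
    (HB_herP h0 hz i).2
  have := (HB_formL (w := fun i => (herB i).2) h0 (hE h1) (hE h2) (hE h3) qdata qdeg).mono
    (show _ ≤ 2^158 by decide +kernel)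
  exact ⟨this.1.neg, this.2.neg⟩

theorem HB_rootN : HB (rootN (X : Fin 4 → MP)) 11 (2^158) := by
  obtain ⟨h0, h1, h2, h3⟩ := args
  have a0 := h0.smul 10
  have a1 := (((a0.add h1).add h2).add h3).pow 3
  have b0 := ((h0.pow 8).smul 10000000000000000)
  have b1 := ((b0.sub (HB_mfL h0 h1 mdata 8 (by decide))).sub (HB_mfL h0 h2 mdata 8 (by decide))).sub
    (HB_mfL h0 h3 mdata 8 (by decide))
  have := (b1.mul a1).mono (show _ ≤ 2^158 by decide +kernel)
  simpa [rootN, mform] using this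

theorem inv_root {F : MP} (hF : HB F 11 (2^158)) {Z : ℕ} {v : ℤ} (hv : aeval XX F = v)
    (hZ : Z = Int.toNat (Int.ofNat hones + v)) : Inv Z F := by
  have hb : ∀ e, |coeff e F| ≤ 2^158 := fun e => by
    have := hF.2.coeff_le e
    push_cast at this
    exact this
  refine ⟨hF.1, hb, ?_⟩
  rw [hZ, ← hv]
  exact Int.toNat_of_nonneg (val_nonneg hF.1 hb)

theorem inv_ZH : Inv ZH (rootH X) := by
  refine inv_root HB_rootH (v := rootH XX) ?_ (by unfold ZH; rfl)
  have := map_rootH (aeval XX : MP →ₐ[ℤ] ℤ).toRingHom (X : Fin 4 → MP)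
  simpa using this
theorem inv_ZF : Inv ZF (rootF X) := by
  refine inv_root HB_rootF (v := rootF XX) ?_ (by unfold ZF; rfl)
  have := map_rootF (aeval XX : MP →ₐ[ℤ] ℤ).toRingHom (X : Fin 4 → MP)
  simpa using this
theorem inv_ZM : Inv ZM (rootN X) := by
  refine inv_root HB_rootN (v := rootN XX) ?_ (by unfold ZM; rfl)
  have := map_rootN (aeval XX : MP →ₐ[ℤ] ℤ).toRingHom (X : Fin 4 → MP)
  simpa using this

theorem rootH_nonneg (x : Fin 4 → ℝ) (hx : ∀ i, 0 ≤ x i) : 0 ≤ rootH x := by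
  have h := run_sound _ _ _ runH (ZH, 0) List.mem_cons_self (rootH X) 0 inv_ZH (fun h => absurd rfl h) x hx
    (fun h => absurd rfl h)
  have := map_rootH (aeval x : MP →ₐ[ℤ] ℝ).toRingHom (X : Fin 4 → MP)
  simp only [AlgHom.toRingHom_eq_coe, RingHom.coe_coe, aeval_X] at this
  rwa [this] at h
theorem rootF_nonneg (x : Fin 4 → ℝ) (hx : ∀ i, 0 ≤ x i) (hN : rootN x ≤ 0) : 0 ≤ rootF x := by
  have h1 := map_rootF (aeval x : MP →ₐ[ℤ] ℝ).toRingHom (X : Fin 4 → MP)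
  have h2 := map_rootN (aeval x : MP →ₐ[ℤ] ℝ).toRingHom (X : Fin 4 → MP)
  simp only [AlgHom.toRingHom_eq_coe, RingHom.coe_coe, aeval_X] at h1 h2
  have h := run_sound _ _ _ runF (ZF, ZM) List.mem_cons_self (rootF X) (rootN X) inv_ZF (fun _ => inv_ZM) x hx
    (fun _ => by rw [h2]; exact hN)
  rwa [h1] at h

theorem sort3 (P : ℝ → ℝ → ℝ → Prop) (h1 : ∀ a b c, P a b c → P b a c) (h2 : ∀ a b c, P a b c → P a c b)
    (h : ∀ a b c, 0 ≤ c → c ≤ b → b ≤ a → P a b c) (a b c : ℝ) (ha : 0 ≤ a) (hb : 0 ≤ b) (hc : 0 ≤ c) :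
    P a b c := by
  rcases le_total a b with x | x <;> rcases le_total b c with y | y <;> rcases le_total a c with z | z
  · exact h1 _ _ _ (h2 _ _ _ (h1 _ _ _ (h c b a ha x y)))
  · exact h1 _ _ _ (h2 _ _ _ (h1 _ _ _ (h c b a ha x y)))
  · exact h1 _ _ _ (h2 _ _ _ (h b c a ha z y))
  · exact h1 _ _ _ (h b a c hc z x)
  · exact h2 _ _ _ (h1 _ _ _ (h c a b hb x z))
  · exact h2 _ _ _ (h a c b hb y z)
  · exact h _ _ _ hc y x
  · exact h _ _ _ hc y x

theorem formH_nonneg (a b c : ℝ) (ha : 0 ≤ a) (hb : 0 ≤ b) (hc : 0 ≤ c) : 0 ≤ form mono 1 a b c := by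
  refine sort3 (fun a b c => 0 ≤ form mono 1 a b c) (fun a b c h => by rwa [form_symm1])
    (fun a b c h => by rwa [form_symm2]) ?_ a b c ha hb hc
  intro a b c hc hcb hba
  have := rootH_nonneg ![1, (a-b)/10, (b-c)/10, c/10] (by
    intro i; fin_cases i <;> simp <;> linarith)
  simp only [rootH] at this
  convert this using 2 <;> simp <;> ring

theorem formF_nonpos (a b c : ℝ) (ha : 0 ≤ a) (hb : 0 ≤ b) (hc : 0 ≤ c) (h : mform 1 a b c ≤ 0) :
    form her 1 a b c ≤ 0 := by
  revert h
  refine sort3 (fun a b c => mform 1 a b c ≤ 0 → form her 1 a b c ≤ 0)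
    (fun a b c h => by rwa [form_symm1, mform_symm1])
    (fun a b c h => by rwa [form_symm2, mform_symm2]) ?_ a b c ha hb hc
  intro a b c hc hcb hba hm
  have := rootF_nonneg ![1, (a-b)/10, (b-c)/10, c/10] (by
    intro i; fin_cases i <;> simp <;> linarith) (by
      simp only [rootN]
      convert hm using 2 <;> simp <;> ring)
  simp only [rootF] at this
  rw [neg_nonneg] at this
  convert this using 2 <;> simp <;> ring
end SB

namespace SB
theorem maj (y : ℝ) (hy : 0 ≤ y) : 10^16 * y^3 ≤ (105787891113959)*((256/25)*y^2)^1 + (259713017646517)*((256/25)*y^2)^2 + (-77253880830536)*((256/25)*y^2)^3 + (19941249817028)*((256/25)*y^2)^4 + (-3283437551091)*((256/25)*y^2)^5 + (322562228319)*((256/25)*y^2)^6 + (-17197282863)*((256/25)*y^2)^7 + (382170733)*((256/25)*y^2)^8 := by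
  have key : (105787891113959)*((256/25)*y^2)^1 + (259713017646517)*((256/25)*y^2)^2 + (-77253880830536)*((256/25)*y^2)^3 + (19941249817028)*((256/25)*y^2)^4 + (-3283437551091)*((256/25)*y^2)^5 + (322562228319)*((256/25)*y^2)^6 + (-17197282863)*((256/25)*y^2)^7 + (382170733)*((256/25)*y^2)^8 - 10^16*y^3 = 10^16*(y^2*((y-(3/10))^2*(y-(3/5))^2*(y-(17/20))^2*(y-(99/100))^2*
    ((132884840691859495000000000/28144450561379551494728391)*y^0 + (3255578545429958480000000000/134100029145396686533705863)*y^1 + (1166670413583168507550000000000/20517304459245693039656997039)*y^2 + (140990514564767455000000000000/1865209496295063003605181549)*y^3 + (10897463332222850285000000000000/184655740133211237356912973351)*y^4 + (4675202741391718000000000000000/184655740133211237356912973351)*y^5 + (853139186385350000000000000000/184655740133211237356912973351)*y^6)))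
    + ((143008054071835234054912/46452186177757231621325)*y^2 + (24563555980578959474384797696/651491911143045173489083125)*y^4 + (38993218774442519522291331825664/136476322765310325136075171875)*y^6 + (2671233867760396209836203075925180416/296836002014549957170963498828125)*y^8 + (6485549397300087126311912093663328468992/66788100453273740363466787236328125)*y^10 + (39952734779816236435084392877498368381681664/45081967805959774745340081384521484375)*y^12 + (9361713385378269206768701954599277561938706432/1127049195148994368633502034613037109375)*y^14 + (1487624949088525532355650124821313111610598883328/28176229878724859215837550865325927734375)*y^16) := by
    ring
  have h2 : 0 ≤ 10^16*(y^2*((y-(3/10))^2*(y-(3/5))^2*(y-(17/20))^2*(y-(99/100))^2*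
    ((132884840691859495000000000/28144450561379551494728391)*y^0 + (3255578545429958480000000000/134100029145396686533705863)*y^1 + (1166670413583168507550000000000/20517304459245693039656997039)*y^2 + (140990514564767455000000000000/1865209496295063003605181549)*y^3 + (10897463332222850285000000000000/184655740133211237356912973351)*y^4 + (4675202741391718000000000000000/184655740133211237356912973351)*y^5 + (853139186385350000000000000000/184655740133211237356912973351)*y^6)))
    + ((143008054071835234054912/46452186177757231621325)*y^2 + (24563555980578959474384797696/651491911143045173489083125)*y^4 + (38993218774442519522291331825664/136476322765310325136075171875)*y^6 + (2671233867760396209836203075925180416/296836002014549957170963498828125)*y^8 + (6485549397300087126311912093663328468992/66788100453273740363466787236328125)*y^10 + (39952734779816236435084392877498368381681664/45081967805959774745340081384521484375)*y^12 + (9361713385378269206768701954599277561938706432/1127049195148994368633502034613037109375)*y^14 + (1487624949088525532355650124821313111610598883328/28176229878724859215837550865325927734375)*y^16) := by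
    positivity
  linarith

theorem mfL_eq (z : ℝ) : mfL 1 z mdata 8 = (105787891113959)*z^1 + (259713017646517)*z^2 + (-77253880830536)*z^3 + (19941249817028)*z^4 + (-3283437551091)*z^5 + (322562228319)*z^6 + (-17197282863)*z^7 + (382170733)*z^8 := by
  simp [mfL, mdata]; ring

theorem mfL_ge (x : ℝ) : 10^16 * |x|^3 / (16/5)^3 ≤ mfL 1 (x^2) mdata 8 := by
  have h := maj (|x| / (16/5)) (by positivity)
  have e : (256/25) * (|x| / (16/5))^2 = x^2 := by rw [div_pow, sq_abs]; ring
  rw [e, ← mfL_eq, div_pow] at h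
  rw [mul_div_assoc]; exact h

theorem p_nonpos (x y z : ℝ) (h : (16/5)^3 ≤ |x|^3 + |y|^3 + |z|^3) :
    form her 1 (x^2) (y^2) (z^2) ≤ 0 := by
  refine formF_nonpos _ _ _ (by positivity) (by positivity) (by positivity) ?_
  unfold mform
  have h1 := mfL_ge x
  have h2 := mfL_ge y
  have h3 := mfL_ge z
  refine mul_nonpos_of_nonpos_of_nonneg ?_ (by positivity)
  have : 10^16 ≤ 10^16 * |x|^3 / (16/5)^3 + 10^16 * |y|^3 / (16/5)^3 + 10^16 * |z|^3 / (16/5)^3 := by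
    rw [← add_div, ← add_div, le_div_iff₀ (by positivity)]
    linarith
  linarith

theorem q_nonneg (x y z : ℝ) : 0 ≤ form mono 1 (x^2) (y^2) (z^2) :=
  formH_nonneg _ _ _ (by positivity) (by positivity) (by positivity)
theorem q_zero : form mono (1:ℝ) 0 0 0 = 10000000000000000010376 := by
  have : form mono (1:ℤ) 0 0 0 = 10000000000000000010376 := by decide +kernel
  have h := map_formL (Int.castRingHom ℝ) mono mono (map_mono _) 1 0 0 0 qdata
  rw [show formL mono (1:ℤ) 0 0 0 qdata = 10000000000000000010376 from this] at h
  simpa [form] using h.symm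
theorem p_zero : form her (1:ℝ) 0 0 0 = 5557307170408304635980 := by
  have : form her (1:ℤ) 0 0 0 = 5557307170408304635980 := by decide +kernel
  have h := map_formL (Int.castRingHom ℝ) her her (map_her _) 1 0 0 0 qdata
  rw [show formL her (1:ℤ) 0 0 0 qdata = 5557307170408304635980 from this] at h
  simpa [form] using h.symm
end SB

namespace SB
noncomputable def gz (ξ : ℝ) : ℝ := Real.exp (-(1/2) * ξ^2)

theorem int_pow_gz (n : ℕ) : Integrable (fun ξ : ℝ => ξ^n * gz ξ) := by
  have h := integrable_rpow_mul_exp_neg_mul_sq (b := 1/2) (by norm_num) (s := n) (by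
    have : (0:ℝ) ≤ n := Nat.cast_nonneg n
    linarith)
  simpa [gz, Real.rpow_natCast] using h

noncomputable def cn (n : ℕ) (x ξ : ℝ) : ℂ := (ξ:ℂ)^n * Complex.exp (Complex.I * x * ξ) * gz ξ

theorem norm_cn (n : ℕ) (x ξ : ℝ) : ‖cn n x ξ‖ = ‖ξ^n * gz ξ‖ := by
  have : ‖Complex.exp (Complex.I * x * ξ)‖ = 1 := by
    rw [Complex.norm_exp]; simp
  unfold cn
  rw [norm_mul, norm_mul, this, mul_one, norm_mul, norm_pow, norm_pow, Complex.norm_real, Complex.norm_real]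

theorem gz_cont : Continuous gz := by unfold gz; fun_prop

theorem int_cn (n : ℕ) (x : ℝ) : Integrable (cn n x) := by
  refine (int_pow_gz n).mono ?_ ?_
  · apply Continuous.aestronglyMeasurable
    unfold cn
    have := gz_cont
    fun_prop
  · exact Eventually.of_forall fun ξ => (norm_cn n x ξ).le

noncomputable def AA (n : ℕ) (x : ℝ) : ℂ := ∫ ξ, cn n x ξ

theorem AA_succ (n : ℕ) (x : ℝ) : AA (n+1) x = n * AA (n-1) x + Complex.I * x * AA n x := by
  have h := integral_mul_deriv_eq_deriv_mul_of_integrable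
    (u := fun ξ : ℝ => (ξ:ℂ)^n * Complex.exp (Complex.I * x * ξ))
    (v := fun ξ : ℝ => (gz ξ : ℂ))
    (u' := fun ξ : ℝ => (n * (ξ:ℂ)^(n-1)) * Complex.exp (Complex.I * x * ξ)
        + (ξ:ℂ)^n * (Complex.exp (Complex.I * x * ξ) * (Complex.I * x)))
    (v' := fun ξ : ℝ => (((-ξ * gz ξ : ℝ)) : ℂ)) ?_ ?_ ?_ ?_ ?_
  · have e1 : (fun ξ : ℝ => (ξ:ℂ)^n * Complex.exp (Complex.I * x * ξ) * (((-ξ * gz ξ : ℝ)) : ℂ)) =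
      fun ξ => - cn (n+1) x ξ := by
      ext ξ; unfold cn; push_cast; ring
    have e2 : (fun ξ : ℝ => ((n * (ξ:ℂ)^(n-1)) * Complex.exp (Complex.I * x * ξ)
        + (ξ:ℂ)^n * (Complex.exp (Complex.I * x * ξ) * (Complex.I * x))) * (gz ξ : ℂ)) =
      fun ξ => n * cn (n-1) x ξ + (Complex.I * x) * cn n x ξ := by
      ext ξ; unfold cn; ring
    rw [e1, e2, integral_neg, integral_add ((int_cn _ _).const_mul _) ((int_cn _ _).const_mul _),
      integral_const_mul, integral_const_mul] at h
    unfold AA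
    linear_combination -h
  · intro ξ _
    have hof : HasDerivAt (fun y : ℝ => (y:ℂ)) 1 ξ := Complex.ofRealCLM.hasDerivAt
    have h1 : HasDerivAt (fun y : ℝ => (y:ℂ)^n) (n * (ξ:ℂ)^(n-1)) ξ := by
      have := hof.pow n
      rw [mul_one] at this
      exact this
    have h2 : HasDerivAt (fun y : ℝ => Complex.exp (Complex.I * x * y))
      (Complex.exp (Complex.I * x * ξ) * (Complex.I * x)) ξ := by
      have := (hof.const_mul (Complex.I * x)).cexp
      simpa using this
    exact h1.mul h2
  · intro ξ _
    have h1 : HasDerivAt gz (-ξ * gz ξ) ξ := by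
      have := (((hasDerivAt_id ξ).pow 2).const_mul (-(1/2):ℝ)).exp
      have e : Real.exp (-(1/2) * (id ^ 2 : ℝ → ℝ) ξ) * (-(1/2) * (((2:ℕ):ℝ) * id ξ ^ (2-1) * 1)) = -ξ * gz ξ := by
        simp [gz]; ring
      rw [e] at this
      exact this
    exact h1.ofReal_comp
  · have e1 : ((fun ξ : ℝ => (ξ:ℂ)^n * Complex.exp (Complex.I * x * ξ)) * fun ξ : ℝ => (((-ξ * gz ξ : ℝ)) : ℂ)) =
      fun ξ => - cn (n+1) x ξ := by
      ext ξ; simp only [Pi.mul_apply]; unfold cn; push_cast; ring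
    rw [e1]; exact (int_cn _ _).neg
  · have e2 : ((fun ξ : ℝ => ((n * (ξ:ℂ)^(n-1)) * Complex.exp (Complex.I * x * ξ)
        + (ξ:ℂ)^n * (Complex.exp (Complex.I * x * ξ) * (Complex.I * x)))) * fun ξ : ℝ => (gz ξ : ℂ)) =
      fun ξ => n * cn (n-1) x ξ + (Complex.I * x) * cn n x ξ := by
      ext ξ; simp only [Pi.mul_apply]; unfold cn; ring
    rw [e2]; exact ((int_cn _ _).const_mul _).add ((int_cn _ _).const_mul _)
  · exact int_cn n x

theorem AA_zero (x : ℝ) : AA 0 x = ((Real.sqrt (2*Real.pi) * gz x : ℝ) : ℂ) := by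
  have h := fourierIntegral_gaussian (b := 1/2) (by norm_num) (x:ℂ)
  have e : (fun ξ : ℝ => Complex.exp (Complex.I * x * ξ) * Complex.exp (-(1/2) * (ξ:ℂ)^2)) = cn 0 x := by
    ext ξ; simp [cn, gz]
  rw [e] at h
  unfold AA; rw [h]
  have e2 : ((Real.pi:ℂ) / (1/2)) = ((2*Real.pi : ℝ) : ℂ) := by push_cast; ring
  rw [e2, show (1/2:ℂ) = ((1/2:ℝ):ℂ) by push_cast; ring, ← Complex.ofReal_cpow (by positivity), ← Real.sqrt_eq_rpow]
  simp only [gz]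
  push_cast
  congr 2
  ring

theorem AA_two (n : ℕ) (x : ℝ) : AA (n+2) x = (2*n+1 - (x:ℂ)^2) * AA n x - (n*(n-1) : ℕ) * AA (n-2) x := by
  have h1 := AA_succ (n+1) x
  have h2 := AA_succ n x
  rcases n with _ | n
  · simp only [Nat.cast_zero, zero_add, zero_mul, mul_zero, Nat.cast_one] at *
    rw [h1, h2]
    linear_combination (x:ℂ)^2 * AA 0 x * Complex.I_sq
  · have h3 := AA_succ n x
    simp only [Nat.add_sub_cancel] at *
    rw [show n+1-2 = n-1 by omega]
    push_cast at *
    linear_combination h1 + Complex.I * x * h2 + (x:ℂ)^2 * AA (n+1) x * Complex.I_sq - (n+1) * h3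

theorem AA_even (k : ℕ) (x : ℝ) :
    AA (2*k) x = ((Real.sqrt (2*Real.pi) * (her k 1 (x^2) * gz x) : ℝ) : ℂ) ∧
    AA (2*(k+1)) x = ((Real.sqrt (2*Real.pi) * (her (k+1) 1 (x^2) * gz x) : ℝ) : ℂ) := by
  induction k with
  | zero =>
    have h := AA_two 0 x
    have e0 : her 0 1 (x^2) = 1 := rfl
    have e1 : her 1 1 (x^2) = 1 - x^2 := by
      unfold her; rw [herP_succ]; simp [herP]
    refine ⟨by simp [e0, AA_zero], ?_⟩
    rw [show 2*(0+1) = 0+2 from rfl, h, AA_zero, e1]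
    push_cast; ring
  | succ k ih =>
    refine ⟨ih.2, ?_⟩
    have h := AA_two (2*(k+1)) x
    rw [show 2*(k+1+1) = 2*(k+1)+2 by ring, h, show 2*(k+1)-2 = 2*k by omega, ih.1, ih.2]
    have e : her (k+2) 1 (x^2) = ((4*(k+1)+1 : ℕ) - x^2) * her (k+1) 1 (x^2) - ((2*(k+1)*(2*(k+1)-1) : ℕ):ℝ) * her k 1 (x^2) := by
      unfold her; rw [herP_succ (k+1), herP_succ k]; ring
    rw [e]; push_cast; ring

theorem int_her (k n : ℕ) : Integrable (fun x : ℝ => x^n * (herP k 1 (x^2)).1 * gz x) ∧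
    Integrable (fun x : ℝ => x^n * (herP k 1 (x^2)).2 * gz x) := by
  induction k generalizing n with
  | zero => simpa [herP] using int_pow_gz n
  | succ k ih =>
    simp only [herP_succ]
    refine ⟨(ih n).2, ?_⟩
    have := (((ih n).2.const_mul ((4*k+1 : ℕ):ℝ)).sub (ih (n+2)).2).sub ((ih n).1.const_mul ((2*k*(2*k-1) : ℕ):ℝ))
    refine this.congr (Eventually.of_forall fun x => ?_)
    simp only [Pi.sub_apply]; ring
end SB

namespace SB
abbrev V3 := EuclideanSpace ℝ (Fin 3)

theorem prod3 (a b c : ℝ → ℂ) (ha : Integrable a) (hb : Integrable b) (hc : Integrable c) :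
    Integrable (fun v : V3 => a (v 0) * b (v 1) * c (v 2)) ∧
    ∫ v : V3, a (v 0) * b (v 1) * c (v 2) = (∫ x, a x) * (∫ x, b x) * ∫ x, c x := by
  have e : (fun v : V3 => a (v 0) * b (v 1) * c (v 2)) =
      (fun u : Fin 3 → ℝ => ∏ i, (![a, b, c] i) (u i)) ∘ (MeasurableEquiv.toLp 2 (Fin 3 → ℝ)).symm := by
    ext v; simp [Fin.prod_univ_three]
  have mp := EuclideanSpace.volume_preserving_symm_measurableEquiv_toLp (Fin 3)
  constructor
  · rw [e, mp.integrable_comp_emb (MeasurableEquiv.measurableEmbedding _)]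
    refine Integrable.fintype_prod (f := ![a, b, c]) ?_
    intro i; fin_cases i <;> simpa
  · rw [e]
    have := mp.integral_comp (MeasurableEquiv.measurableEmbedding _) (fun u : Fin 3 → ℝ => ∏ i, (![a, b, c] i) (u i))
    simp only [Function.comp_def]
    rw [this, integral_fintype_prod_volume_eq_prod (fun i => ![a, b, c] i)]
    simp [Fin.prod_univ_three]

section
variable {R : Type} [CommRing R]
def termG (α β γ : ℕ → R) (i j k : ℕ) : R :=
  α i * β j * γ k + α i * β k * γ j + α j * β i * γ k + α k * β i * γ j + α k * β j * γ i + α j * β k * γ i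
def formG (α β γ : ℕ → R) : List (ℕ × ℕ × ℕ × ℤ) → R
  | [] => 0
  | q :: L => formG α β γ L + (q.2.2.2 : R) * termG α β γ q.1 q.2.1 q.2.2.1

theorem formL_formG (E : ℕ → R → R → R) (a b c u v w : R) (L) :
    formL E 1 a b c L * (u * v * w) =
    formG (fun i => E i 1 a * u) (fun i => E i 1 b * v) (fun i => E i 1 c * w) L := by
  induction L with
  | nil => simp [formL, formG]
  | cons q L ih =>
    rw [formL_cons, formG, ← ih]
    simp only [term, termG, one_pow]
    ring

theorem formG_smul (α β γ : ℕ → R) (s : R) (L) :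
    formG (fun i => s * α i) (fun i => s * β i) (fun i => s * γ i) L = s^3 * formG α β γ L := by
  induction L with
  | nil => simp [formG]
  | cons q L ih =>
    rw [formG, formG, ih]
    simp only [termG]
    ring

theorem map_formG {S : Type} [CommRing S] (f : R →+* S) (α β γ : ℕ → R) (L) :
    f (formG α β γ L) = formG (fun i => f (α i)) (fun i => f (β i)) (fun i => f (γ i)) L := by
  induction L with
  | nil => simp [formG]
  | cons q L ih => simp only [formG, termG, map_add, map_mul, map_intCast, ih]
end

theorem int_formG (α β γ : ℕ → ℝ → ℂ) (ha : ∀ i, Integrable (α i)) (hb : ∀ i, Integrable (β i))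
    (hc : ∀ i, Integrable (γ i)) (L) :
    Integrable (fun v : V3 => formG (fun i => α i (v 0)) (fun i => β i (v 1)) (fun i => γ i (v 2)) L) ∧
    ∫ v : V3, formG (fun i => α i (v 0)) (fun i => β i (v 1)) (fun i => γ i (v 2)) L =
      formG (fun i => ∫ x, α i x) (fun i => ∫ x, β i x) (fun i => ∫ x, γ i x) L := by
  induction L with
  | nil => simp [formG]
  | cons q L ih =>
    obtain ⟨i, j, k, c⟩ := q
    simp only [formG, termG]
    have P := fun i j k => prod3 (α i) (β j) (γ k) (ha i) (hb j) (hc k)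
    have I1 := (P i j k).1
    have I2 := (P i k j).1
    have I3 := (P j i k).1
    have I4 := (P k i j).1
    have I5 := (P k j i).1
    have I6 := (P j k i).1
    have I12 := I1.add I2
    have I13 := I12.add I3
    have I14 := I13.add I4
    have I15 := I14.add I5
    have I16 := I15.add I6
    have J := I16.const_mul (c : ℂ)
    refine ⟨ih.1.add J, ?_⟩
    have e := integral_add ih.1 J
    refine e.trans ?_
    rw [ih.2, integral_const_mul]
    congr 2
    rw [integral_add' I15 I6, integral_add' I14 I5, integral_add' I13 I4, integral_add' I12 I3,
      integral_add' I1 I2, (P i j k).2, (P i k j).2, (P j i k).2, (P k i j).2, (P k j i).2, (P j k i).2]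

noncomputable def gg (v : V3) : ℝ := gz (v 0) * gz (v 1) * gz (v 2)
noncomputable def ff (v : V3) : ℝ := form her 1 (v 0 ^ 2) (v 1 ^ 2) (v 2 ^ 2) * gg v
noncomputable def ww (v : V3) : ℝ := form mono 1 (v 0 ^ 2) (v 1 ^ 2) (v 2 ^ 2) * gg v
def dt (x y : V3) : ℝ := x 0 * y 0 + x 1 * y 1 + x 2 * y 2
noncomputable def ph (x y : V3) : ℂ := Complex.exp (dt x y * Complex.I)

theorem gz_pos (x : ℝ) : 0 < gz x := Real.exp_pos _
theorem gg_nonneg (x : V3) : 0 ≤ gg x :=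
  mul_nonneg (mul_nonneg (gz_pos _).le (gz_pos _).le) (gz_pos _).le
theorem ww_nonneg (v : V3) : 0 ≤ ww v := mul_nonneg (q_nonneg _ _ _) (gg_nonneg _)
theorem gz_zero : gz 0 = 1 := by simp [gz]
theorem ff_zero : ff 0 = 5557307170408304635980 := by
  simp [ff, gg, gz_zero, p_zero]
theorem ww_zero : ww 0 = 10000000000000000010376 := by
  simp [ww, gg, gz_zero, q_zero]
theorem ff_nonpos (v : V3) (h : (16/5)^3 ≤ |v 0|^3 + |v 1|^3 + |v 2|^3) : ff v ≤ 0 :=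
  mul_nonpos_of_nonpos_of_nonneg (p_nonpos _ _ _ h) (gg_nonneg _)
theorem ff_neg (v : V3) : ff (-v) = ff v := by simp [ff, gg, gz]

noncomputable def KK : ℝ := Real.sqrt (2*Real.pi)^3

theorem ph_mul (ξ x : V3) : ph ξ x = Complex.exp (Complex.I * x 0 * ξ 0) *
    Complex.exp (Complex.I * x 1 * ξ 1) * Complex.exp (Complex.I * x 2 * ξ 2) := by
  unfold ph dt
  rw [← Complex.exp_add, ← Complex.exp_add]
  congr 1
  push_cast; ring

theorem wph_eq (x ξ : V3) : (ww ξ : ℂ) * ph ξ x =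
    formG (fun i => cn (2*i) (x 0) (ξ 0)) (fun i => cn (2*i) (x 1) (ξ 1)) (fun i => cn (2*i) (x 2) (ξ 2)) qdata := by
  have h := map_formL Complex.ofRealHom mono mono (map_mono _) 1 (ξ 0 ^2) (ξ 1 ^2) (ξ 2 ^2) qdata
  have h2 := formL_formG mono ((ξ 0:ℂ)^2) ((ξ 1:ℂ)^2) ((ξ 2:ℂ)^2)
    (Complex.exp (Complex.I * x 0 * ξ 0) * gz (ξ 0)) (Complex.exp (Complex.I * x 1 * ξ 1) * gz (ξ 1))
    (Complex.exp (Complex.I * x 2 * ξ 2) * gz (ξ 2)) qdata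
  simp only [Complex.ofRealHom_eq_coe, Complex.ofReal_one, Complex.ofReal_pow] at h
  rw [ph_mul]
  unfold ww gg form
  rw [Complex.ofReal_mul, h]
  have e : ∀ (i : ℕ) (x ξ : ℝ), mono i 1 ((ξ:ℂ)^2) * (Complex.exp (Complex.I * x * ξ) * gz ξ) = cn (2*i) x ξ := by
    intro i x ξ; simp only [mono, cn]; rw [← pow_mul]; ring
  simp only [e] at h2
  rw [← h2]
  push_cast; ring

theorem ff_eq (x : V3) : Integrable (fun ξ : V3 => (ww ξ : ℂ) * ph ξ x) ∧
    ∫ ξ : V3, (ww ξ : ℂ) * ph ξ x = KK * ff x := by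
  have h := int_formG (fun i => cn (2*i) (x 0)) (fun i => cn (2*i) (x 1)) (fun i => cn (2*i) (x 2))
    (fun i => int_cn _ _) (fun i => int_cn _ _) (fun i => int_cn _ _) qdata
  simp only [wph_eq]
  refine ⟨h.1, ?_⟩
  rw [h.2]
  have e : ∀ (i : ℕ) (x : ℝ), ∫ ξ, cn (2*i) x ξ = Complex.ofRealHom (Real.sqrt (2*Real.pi) * (her i 1 (x^2) * gz x)) :=
    fun i x => (AA_even i x).1
  simp only [e]
  rw [← map_formG, formG_smul, ← formL_formG]
  simp [KK, ff, form, gg]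

theorem ww_int : Integrable ww := by
  have h := (ff_eq 0).1
  have e : (fun ξ : V3 => (ww ξ : ℂ) * ph ξ 0) = fun ξ => ((ww ξ : ℝ) : ℂ) := by
    ext ξ; simp [ph, dt]
  rw [e] at h
  exact h.re

theorem ff_int : Integrable ff := by
  have I : ∀ i, Integrable (fun x : ℝ => ((her i 1 (x^2) * gz x : ℝ) : ℂ)) := fun i => by
    have := (int_her i 0).2
    simp only [pow_zero, one_mul] at this
    exact this.ofReal
  have h := (int_formG _ _ _ I I I qdata).1
  have e : ∀ v : V3, formG (fun i => ((her i 1 (v 0^2) * gz (v 0) : ℝ) : ℂ)) (fun i => ((her i 1 (v 1^2) * gz (v 1) : ℝ) : ℂ))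
    (fun i => ((her i 1 (v 2^2) * gz (v 2) : ℝ) : ℂ)) qdata = ((ff v : ℝ) : ℂ) := by
    intro v
    have := map_formG Complex.ofRealHom (fun i => her i 1 (v 0^2) * gz (v 0)) (fun i => her i 1 (v 1^2) * gz (v 1))
      (fun i => her i 1 (v 2^2) * gz (v 2)) qdata
    rw [← formL_formG] at this
    exact this.symm
  simp only [e] at h
  exact h.re

theorem gg_cont : Continuous gg := by
  unfold gg
  have := gz_cont
  fun_prop

theorem herP_cont (k : ℕ) : Continuous (fun z : ℝ => (herP k 1 z).1) ∧ Continuous (fun z : ℝ => (herP k 1 z).2) := by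
  induction k with
  | zero => simp only [herP]; exact ⟨continuous_const, continuous_const⟩
  | succ k ih =>
    simp only [herP_succ]
    obtain ⟨h1, h2⟩ := ih
    refine ⟨h2, by fun_prop⟩

theorem form_cont (E : ℕ → ℝ → ℝ → ℝ) (hE : ∀ i, Continuous (fun z : ℝ => E i 1 z)) (L) :
    Continuous (fun v : V3 => formL E 1 (v 0 ^ 2) (v 1 ^ 2) (v 2 ^ 2) L) := by
  induction L with
  | nil => exact continuous_const
  | cons q L ih =>
    simp only [formL_cons, term]
    have H : ∀ i j, Continuous (fun v : V3 => E i 1 (v j ^ 2)) := fun i j => by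
      have := hE i
      exact this.comp (by fun_prop : Continuous (fun v : V3 => v j ^ 2))
    fun_prop (disch := exact H _ _)

theorem ff_cont : Continuous ff := by
  unfold ff form
  exact (form_cont her (fun i => (herP_cont i).2) qdata).mul gg_cont
theorem ww_cont : Continuous ww := by
  unfold ww form
  exact (form_cont mono (fun i => by unfold mono; fun_prop) qdata).mul gg_cont

theorem KK_pos : 0 < KK := by unfold KK; positivity
theorem KK_sq : KK * KK = (2*Real.pi)^3 := by
  unfold KK
  rw [← mul_pow, Real.mul_self_sqrt (by positivity)]

open Real in
theorem ff_integral : ∫ x, ff x = KK * ww 0 := by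
  have hwc : Continuous (fun x : V3 => (ww x : ℂ)) := Complex.continuous_ofReal.comp ww_cont
  have hwi : Integrable (fun x : V3 => (ww x : ℂ)) := ww_int.ofReal
  have hF : (FourierTransform.fourier (fun x : V3 => (ww x : ℂ)) : V3 → ℂ) = fun v => ((KK * ff ((2*Real.pi) • v) : ℝ) : ℂ) := by
    ext v
    rw [Real.fourier_eq']
    have h := (ff_eq (-((2*Real.pi) • v))).2
    rw [ff_neg] at h
    rw [Complex.ofReal_mul, ← h]
    congr 1
    ext ξ
    rw [smul_eq_mul, mul_comm]
    congr 1
    unfold ph dt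
    congr 2
    rw [PiLp.inner_apply, Fin.sum_univ_three]
    simp
    ring
  have hFi : Integrable (fun v : V3 => ((KK * ff ((2*Real.pi) • v) : ℝ) : ℂ)) := by
    refine Integrable.ofReal ?_
    refine Integrable.const_mul ?_ _
    exact ff_int.comp_smul (by positivity)
  have key := congrFun (hwc.fourierInv_fourier_eq hwi (by rw [hF]; exact hFi)) 0
  rw [hF, Real.fourierInv_eq'] at key
  simp only [inner_zero_right, mul_zero, Complex.ofReal_zero, zero_mul, Complex.exp_zero, one_smul] at key
  rw [integral_complex_ofReal] at key
  have key := Complex.ofReal_injective key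
  rw [integral_const_mul, Measure.integral_comp_smul, finrank_euclideanSpace_fin, abs_of_nonneg (by positivity), smul_eq_mul,
    ← KK_sq] at key
  have := KK_pos
  field_simp at key
  linarith
end SB

namespace SB
attribute [local irreducible] ff ww
theorem ph_norm (x y : V3) : ‖ph x y‖ = 1 := by
  unfold ph; exact Complex.norm_exp_ofReal_mul_I _
theorem ph_conj (x y : V3) : (starRingEnd ℂ) (ph x y) = ph x (-y) := by
  unfold ph; rw [← Complex.exp_conj]
  congr 1
  simp [dt]; ring
theorem ph_add (x y z : V3) : ph x (y + z) = ph x y * ph x z := by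
  unfold ph; rw [← Complex.exp_add]
  congr 1
  simp [dt]; ring
theorem ph_cont : Continuous (fun p : V3 × V3 => ph p.1 p.2) := by
  unfold ph dt; fun_prop

theorem ff_bdd (x : V3) : ‖ff x‖ ≤ KK⁻¹ * ∫ ξ, ww ξ := by
  have h := (ff_eq x).2
  have h2 := norm_integral_le_integral_norm (μ := volume) (fun ξ : V3 => (ww ξ : ℂ) * ph ξ x)
  rw [h] at h2
  have e : ∀ ξ : V3, ‖(ww ξ : ℂ) * ph ξ x‖ = ww ξ := fun ξ => by
    rw [norm_mul, ph_norm, mul_one, Complex.norm_real, Real.norm_of_nonneg (ww_nonneg ξ)]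
  simp only [e] at h2
  rw [norm_mul, Complex.norm_real, Complex.norm_real, Real.norm_of_nonneg KK_pos.le] at h2
  rw [inv_mul_eq_div, le_div_iff₀ KK_pos]; linarith

noncomputable def hat (μ : Measure V3) (ξ : V3) : ℂ := ∫ x, ph ξ x ∂μ
noncomputable def GG (μ ν : Measure V3) : ℝ := ∫ z : V3 × V3, ff (z.1 - z.2) ∂(μ.prod ν)

theorem fub (μ ν : Measure V3) [IsFiniteMeasure μ] [IsFiniteMeasure ν] :
    Integrable (fun ξ : V3 => (ww ξ : ℂ) * (hat μ ξ * (starRingEnd ℂ) (hat ν ξ))) ∧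
    ∫ ξ : V3, (ww ξ : ℂ) * (hat μ ξ * (starRingEnd ℂ) (hat ν ξ)) = ((KK * GG μ ν : ℝ) : ℂ) := by
  have e : ∀ ξ : V3, (ww ξ : ℂ) * (hat μ ξ * (starRingEnd ℂ) (hat ν ξ)) =
      ∫ z : V3 × V3, (ww ξ : ℂ) * ph ξ (z.1 - z.2) ∂(μ.prod ν) := by
    intro ξ
    unfold hat
    rw [integral_const_mul, ← integral_conj, ← integral_prod_mul]
    simp only [ph_conj, sub_eq_add_neg, ph_add]
  have hI : Integrable (fun p : V3 × (V3 × V3) => (ww p.1 : ℂ) * ph p.1 (p.2.1 - p.2.2))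
      ((volume : Measure V3).prod (μ.prod ν)) := by
    have h0 : Integrable (fun p : V3 × (V3 × V3) => ww p.1 * (1:ℝ)) ((volume : Measure V3).prod (μ.prod ν)) :=
      ww_int.mul_prod (integrable_const 1)
    refine h0.mono ?_ ?_
    · apply Continuous.aestronglyMeasurable
      have h1 := ww_cont
      have h2 : Continuous (fun p : V3 × (V3 × V3) => ph p.1 (p.2.1 - p.2.2)) :=
        ph_cont.comp (by fun_prop : Continuous (fun p : V3 × (V3 × V3) => (p.1, p.2.1 - p.2.2)))
      fun_prop
    · refine Eventually.of_forall fun p => ?_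
      rw [norm_mul, ph_norm, Complex.norm_real]; simp
  simp only [e]
  refine ⟨hI.integral_prod_left, ?_⟩
  rw [integral_integral_swap hI]
  simp only [(ff_eq _).2]
  unfold GG
  rw [integral_const_mul, integral_complex_ofReal]
  push_cast; rfl

theorem pd (μ ν : Measure V3) [IsFiniteMeasure μ] [IsFiniteMeasure ν] (t : ℝ) :
    0 ≤ GG μ μ - t * (GG μ ν + GG ν μ) + t^2 * GG ν ν := by
  have h1 := fub μ μ
  have h2 := fub μ ν
  have h3 := fub ν μ
  have h4 := fub ν ν
  have e : ∀ ξ : V3, (ww ξ : ℂ) * (hat μ ξ * (starRingEnd ℂ) (hat μ ξ))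
     - t * ((ww ξ : ℂ) * (hat μ ξ * (starRingEnd ℂ) (hat ν ξ))
     + (ww ξ : ℂ) * (hat ν ξ * (starRingEnd ℂ) (hat μ ξ)))
     + t^2 * ((ww ξ : ℂ) * (hat ν ξ * (starRingEnd ℂ) (hat ν ξ))) =
     ((ww ξ * Complex.normSq (hat μ ξ - t * hat ν ξ) : ℝ) : ℂ) := by
    intro ξ
    rw [Complex.ofReal_mul, Complex.normSq_eq_conj_mul_self]
    simp only [map_sub, map_mul, Complex.conj_ofReal]
    ring
  have i1 := (h2.1.add h3.1).const_mul (t:ℂ)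
  have i2 := h1.1.sub i1
  have i3 := h4.1.const_mul ((t:ℂ)^2)
  have E := integral_add i2 i3
  have E' := E.symm.trans (integral_congr_ae (Eventually.of_forall e))
  rw [integral_sub' h1.1 i1, integral_const_mul, integral_const_mul, integral_add' h2.1 h3.1, h1.2, h2.2, h3.2, h4.2,
    integral_complex_ofReal] at E'
  have E2 : KK * GG μ μ - t * (KK * GG μ ν + KK * GG ν μ) + t^2 * (KK * GG ν ν) =
    ∫ ξ, ww ξ * Complex.normSq (hat μ ξ - t * hat ν ξ) := by exact_mod_cast E'
  have hp : 0 ≤ ∫ ξ, ww ξ * Complex.normSq (hat μ ξ - t * hat ν ξ) :=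
    integral_nonneg fun ξ => mul_nonneg (ww_nonneg ξ) (Complex.normSq_nonneg _)
  rw [← E2] at hp
  have : 0 ≤ KK * (GG μ μ - t * (GG μ ν + GG ν μ) + t^2 * GG ν ν) := by linarith
  exact nonneg_of_mul_nonneg_right this KK_pos

theorem ff_prod_int (μ ν : Measure V3) [IsFiniteMeasure μ] [IsFiniteMeasure ν] :
    Integrable (fun z : V3 × V3 => ff (z.1 - z.2)) (μ.prod ν) := by
  refine Integrable.of_bound ?_ (KK⁻¹ * ∫ ξ, ww ξ) ?_
  · exact (ff_cont.comp (by fun_prop)).aestronglyMeasurable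
  · exact Eventually.of_forall fun z => ff_bdd _

theorem GG_eq (μ ν : Measure V3) [IsFiniteMeasure μ] [IsFiniteMeasure ν] :
    GG μ ν = ∫ x, ∫ y, ff (x - y) ∂ν ∂μ := integral_prod _ (ff_prod_int μ ν)

theorem GG_symm (μ ν : Measure V3) [IsFiniteMeasure μ] [IsFiniteMeasure ν] :
    GG μ ν = GG ν μ := by
  have h := integral_prod_swap (μ := μ) (ν := ν) (fun z : V3 × V3 => ff (z.1 - z.2))
  unfold GG
  refine h.symm.trans ?_
  refine integral_congr_ae (Eventually.of_forall fun z => ?_)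
  change ff (z.2 - z.1) = ff (z.1 - z.2)
  rw [← ff_neg, neg_sub]

noncomputable def dS (S : Finset V3) : Measure V3 := ∑ x ∈ S, Measure.dirac x
instance (S : Finset V3) : IsFiniteMeasure (dS S) := by
  unfold dS; infer_instance

theorem int_dS (S : Finset V3) (h : V3 → ℝ) : ∫ x, h x ∂(dS S) = ∑ x ∈ S, h x := by
  unfold dS
  rw [integral_finsetSum_measure (fun i _ => integrable_dirac (by simp))]
  simp

noncomputable def eta (τ : ℝ) : ℝ := ∫ z in (closedBall (0:V3) τ)ᶜ, |ff z|
noncomputable def II : ℝ := ∫ z, ff z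
noncomputable def AC : ℝ := ∫ z, |ff z|
noncomputable def conv (Ω : Set V3) (x : V3) : ℝ := ∫ y in Ω, ff (x - y)

theorem ff_int_sub (x : V3) : Integrable (fun y => ff (x - y)) := ff_int.comp_sub_left x

theorem conv_near (c x : V3) (P τ : ℝ) (hx : x ∈ closedBall c P) :
    |conv (closedBall c (P + τ)) x - II| ≤ eta τ := by
  have hm : MeasurableSet (closedBall c (P + τ)) := measurableSet_closedBall
  have e := integral_add_compl hm (ff_int_sub x)
  rw [integral_sub_left_eq_self ff volume x] at e
  have e2 : conv (closedBall c (P + τ)) x - II = - ∫ y in (closedBall c (P + τ))ᶜ, ff (x - y) := by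
    unfold conv II; linarith
  rw [e2, abs_neg]
  have n1 : |∫ y in (closedBall c (P + τ))ᶜ, ff (x - y)| ≤ ∫ y in (closedBall c (P + τ))ᶜ, |ff (x - y)| :=
    norm_integral_le_integral_norm (fun y => ff (x - y))
  refine n1.trans ?_
  have e3 : eta τ = ∫ y, (closedBall (0:V3) τ)ᶜ.indicator (fun z => |ff z|) (x - y) := by
    rw [integral_sub_left_eq_self (fun z => (closedBall (0:V3) τ)ᶜ.indicator (fun z => |ff z|) z)]
    rw [integral_indicator measurableSet_closedBall.compl]
    rfl
  rw [e3, ← integral_indicator hm.compl]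
  refine integral_mono ((ff_int_sub x).abs.indicator hm.compl)
    ((ff_int.abs.indicator measurableSet_closedBall.compl).comp_sub_left x) ?_
  intro y
  by_cases hy : y ∈ (closedBall c (P + τ))ᶜ
  · have : x - y ∈ (closedBall (0:V3) τ)ᶜ := by
      simp only [Set.mem_compl_iff, mem_closedBall, not_le, dist_zero_right] at *
      rw [dist_comm, dist_eq_norm] at hx
      rw [dist_comm, dist_eq_norm] at hy
      have := norm_add_le (c - x) (x - y)
      rw [sub_add_sub_cancel] at this
      linarith
    simp only [Set.indicator_of_mem hy, Set.indicator_of_mem this]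
    exact le_rfl
  · rw [Set.indicator_of_notMem hy]
    exact Set.indicator_nonneg (fun _ _ => abs_nonneg _) _

theorem conv_le (Ω : Set V3) (x : V3) : conv Ω x ≤ AC := by
  have n1 : |conv Ω x| ≤ ∫ y in Ω, |ff (x - y)| :=
    norm_integral_le_integral_norm (fun y => ff (x - y))
  have n2 : ∫ y in Ω, |ff (x - y)| ≤ ∫ y, |ff (x - y)| :=
    setIntegral_le_integral (ff_int_sub x).abs (Eventually.of_forall fun _ => abs_nonneg _)
  rw [integral_sub_left_eq_self (fun z => |ff z|) volume x] at n2
  exact (le_abs_self _).trans (n1.trans n2)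

theorem II_pos : 0 < II := by
  unfold II; rw [ff_integral, ww_zero]
  have := KK_pos
  positivity
theorem eta_nonneg (τ : ℝ) : 0 ≤ eta τ := integral_nonneg fun _ => abs_nonneg _
theorem AC_nonneg : 0 ≤ AC := integral_nonneg fun _ => abs_nonneg _

theorem main_bound (c : V3) (P τ : ℝ) (hP : 0 < P) (hτ : 0 ≤ τ) (S : Finset V3)
    (hS : ∀ x ∈ S, x ∈ closedBall c P)
    (hs : ∀ x ∈ S, ∀ y ∈ S, x ≠ y → ff (x - y) ≤ 0) :
    (S.card / volume.real (closedBall c (P + τ))) *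
      (II - 3 * eta τ - (1 - volume.real (closedBall c P) / volume.real (closedBall c (P + τ))) * AC) ≤ ff 0 := by
  set Ω := closedBall c (P + τ) with hΩ
  set ν := (volume : Measure V3).restrict Ω with hν
  have hfin : volume Ω ≠ ⊤ := measure_closedBall_lt_top.ne
  have : IsFiniteMeasure ν := ⟨by rw [hν, Measure.restrict_apply_univ]; exact measure_closedBall_lt_top⟩
  set N : ℝ := (S.card : ℝ) with hN
  have hN0 : 0 ≤ N := Nat.cast_nonneg _
  set W := volume.real Ω with hW
  set U := volume.real (closedBall c P) with hU
  have hsub : closedBall c P ⊆ Ω := closedBall_subset_closedBall (by linarith)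
  have hU0 : 0 < U := by
    rw [hU, measureReal_def, ENNReal.toReal_pos_iff]
    exact ⟨measure_closedBall_pos _ _ hP, measure_closedBall_lt_top⟩
  have hUW : U ≤ W := measureReal_mono hsub hfin
  have hW0 : 0 < W := lt_of_lt_of_le hU0 hUW
  have g1 : GG (dS S) (dS S) ≤ N * ff 0 := by
    rw [GG_eq, int_dS]
    simp only [int_dS]
    have : ∀ x ∈ S, ∑ y ∈ S, ff (x - y) ≤ ff 0 := by
      intro x hx
      rw [← Finset.add_sum_erase _ _ hx, sub_self]
      have : ∑ y ∈ S.erase x, ff (x - y) ≤ 0 := Finset.sum_nonpos fun y hy =>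
        hs x hx y (Finset.mem_of_mem_erase hy) (Finset.ne_of_mem_erase hy).symm
      linarith
    refine (Finset.sum_le_sum this).trans ?_
    simp [hN]
  have g2 : N * (II - eta τ) ≤ GG (dS S) ν := by
    rw [GG_eq, int_dS]
    have : ∀ x ∈ S, II - eta τ ≤ conv Ω x := by
      intro x hx
      have := abs_le.1 (conv_near c x P τ (hS x hx))
      linarith [this.1]
    have h := Finset.sum_le_sum this
    rw [Finset.sum_const, nsmul_eq_mul] at h
    exact h
  have g4 : GG ν ν ≤ W * (II + eta τ) + (W - U) * AC := by
    rw [GG_eq]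
    have h1 : ∀ x, conv Ω x ≤ (II + eta τ) + (closedBall c P)ᶜ.indicator (fun _ => AC) x := by
      intro x
      by_cases hx : x ∈ (closedBall c P)ᶜ
      · rw [Set.indicator_of_mem hx]
        linarith [conv_le Ω x, II_pos, eta_nonneg τ]
      · rw [Set.indicator_of_notMem hx]
        have := abs_le.1 (conv_near c x P τ (by simpa using hx))
        linarith [this.2]
    have i1 : Integrable (fun x => conv Ω x) ν := (ff_prod_int ν ν).integral_prod_left
    have i3 : Integrable (fun x => (closedBall c P)ᶜ.indicator (fun _ => AC) x) ν :=
      (integrable_const AC).indicator measurableSet_closedBall.compl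
    refine (integral_mono i1 ((integrable_const _).add i3) h1).trans ?_
    rw [integral_add' (integrable_const _) i3, integral_indicator measurableSet_closedBall.compl]
    simp only [integral_const, smul_eq_mul]
    have m1 : ν.real Set.univ = W := by simp [hν, hW]
    have m2 : (ν.restrict (closedBall c P)ᶜ).real Set.univ = W - U := by
      rw [measureReal_restrict_apply_univ, hν, measureReal_restrict_apply measurableSet_closedBall.compl,
        Set.inter_comm, ← Set.sdiff_eq, measureReal_sdiff hsub measurableSet_closedBall]
    rw [m1, m2]
  have h := pd (dS S) ν (N / W)
  rw [GG_symm ν (dS S)] at h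
  rcases hN0.eq_or_lt with h0 | h0
  · rw [← h0]; simp [ff_zero]
  · have ht : 0 < N / W := by positivity
    have k1 := mul_le_mul_of_nonneg_left g2 ht.le
    have k2 := mul_le_mul_of_nonneg_left g4 (sq_nonneg (N / W))
    have k3 : 0 ≤ N * ff 0 - 2 * ((N / W) * (N * (II - eta τ))) + (N/W)^2 * (W * (II + eta τ) + (W - U) * AC) := by
      linarith
    have k4 : N * ff 0 - 2 * ((N / W) * (N * (II - eta τ))) + (N/W)^2 * (W * (II + eta τ) + (W - U) * AC)
      = N * (ff 0 - (N/W) * (II - 3 * eta τ - (1 - U/W) * AC)) := by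
      field_simp; ring
    rw [k4] at k3
    have := nonneg_of_mul_nonneg_right k3 h0
    linarith
end SB

namespace SB
attribute [local irreducible] ff ww
open Topology

def BB : Set V3 := {x : V3 | |x 0| ^ 3 + |x 1| ^ 3 + |x 2| ^ 3 ≤ 1}
def s3 (x : V3) : ℝ := |x 0| ^ 3 + |x 1| ^ 3 + |x 2| ^ 3
theorem s3_cont : Continuous s3 := by unfold s3; fun_prop
theorem s3_smul (t : ℝ) (x : V3) : s3 (t • x) = |t|^3 * s3 x := by
  simp only [s3, PiLp.smul_apply, smul_eq_mul, abs_mul]; ring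
theorem s3_neg (x : V3) : s3 (-x) = s3 x := by simp [s3]

theorem lt_interior {x : V3} (h : s3 x < 1) : x ∈ interior BB := by
  have ho : IsOpen {y : V3 | s3 y < 1} := isOpen_lt s3_cont continuous_const
  exact interior_maximal (fun y hy => (show s3 y < 1 from hy).le) ho h

theorem pack_dist (X : Set V3) (hX : IsTranslativePacking BB X) {x y : V3} (hx : x ∈ X) (hy : y ∈ X) (h : x ≠ y) :
    8 ≤ s3 (x - y) := by
  by_contra! hlt
  have hd := hX x hx y hy h
  have e : s3 ((1/2:ℝ) • (x - y)) < 1 := by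
    rw [s3_smul, abs_of_pos (by norm_num)]; linarith
  have h1 : x + (-((1/2:ℝ) • (x - y))) ∈ (fun z => x + z) '' interior BB :=
    ⟨_, lt_interior (by rw [s3_neg]; exact e), rfl⟩
  have h2 : y + ((1/2:ℝ) • (x - y)) ∈ (fun z => y + z) '' interior BB := ⟨_, lt_interior e, rfl⟩
  have e3 : x + (-((1/2:ℝ) • (x - y))) = y + ((1/2:ℝ) • (x - y)) := by
    module
  rw [e3] at h1
  exact Set.disjoint_left.1 hd h1 h2

theorem ff_scaled (X : Set V3) (hX : IsTranslativePacking BB X) {x y : V3} (hx : x ∈ X) (hy : y ∈ X) (h : x ≠ y) :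
    ff ((8/5:ℝ) • x - (8/5:ℝ) • y) ≤ 0 := by
  rw [← smul_sub]
  apply ff_nonpos
  have := s3_smul (8/5) (x - y)
  have h2 := pack_dist X hX hx hy h
  rw [abs_of_pos (by norm_num)] at this
  have e : s3 ((8/5:ℝ) • (x - y)) ≥ (16/5)^3 := by rw [this]; linarith
  exact e

noncomputable def kap : ℝ := volume.real (ball (0:V3) 1)
theorem kap_pos : 0 < kap := by
  unfold kap
  rw [measureReal_def, ENNReal.toReal_pos_iff]
  exact ⟨measure_ball_pos _ _ one_pos, measure_ball_lt_top⟩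
theorem vol_ball (c : V3) {r : ℝ} (hr : 0 ≤ r) : volume.real (closedBall c r) = r^3 * kap := by
  rw [Measure.addHaar_real_closedBall _ _ hr]; simp [kap]

noncomputable def brk (τ r : ℝ) : ℝ :=
  II - 3 * eta τ - (1 - ((8/5*(r+2))/(8/5*(r+2)+τ))^3) * AC

theorem card_bound (X : Set V3) (hX : IsTranslativePacking BB X) (c : V3) (r τ : ℝ) (hr : 0 < r) (hτ : 0 ≤ τ)
    (S : Finset V3) (hS : ∀ x ∈ S, x ∈ X ∧ x ∈ closedBall c (r+2)) :
    S.card * brk τ r ≤ ff 0 * ((8/5*(r+2)+τ)^3 * kap) := by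
  have inj : Function.Injective (fun x : V3 => (8/5:ℝ) • x) := smul_right_injective V3 (by norm_num)
  have h := main_bound ((8/5:ℝ) • c) (8/5*(r+2)) τ (by positivity) hτ (S.map ⟨_, inj⟩) ?_ ?_
  · rw [Finset.card_map, vol_ball _ (by positivity), vol_ball _ (by positivity)] at h
    have hk := kap_pos
    rw [mul_div_mul_right _ _ hk.ne', ← div_pow] at h
    change _ * brk τ r ≤ _ at h
    rw [div_mul_eq_mul_div, div_le_iff₀ (by positivity)] at h
    exact h
  · intro x hx
    simp only [Finset.mem_map, Function.Embedding.coeFn_mk] at hx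
    obtain ⟨y, hy, rfl⟩ := hx
    have := (hS y hy).2
    rw [mem_closedBall, dist_smul₀, Real.norm_of_nonneg (by norm_num)]
    rw [mem_closedBall] at this
    linarith
  · intro x hx y hy hne
    simp only [Finset.mem_map, Function.Embedding.coeFn_mk] at hx hy
    obtain ⟨x, hx, rfl⟩ := hx
    obtain ⟨y, hy, rfl⟩ := hy
    exact ff_scaled X hX (hS x hx).1 (hS y hy).1 (fun h => hne (by rw [h]))

theorem fin_X (X : Set V3) (hX : IsTranslativePacking BB X) (c : V3) (r τ : ℝ) (hr : 0 < r) (hτ : 0 ≤ τ)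
    (hb : 0 < brk τ r) : (X ∩ closedBall c (r+2)).Finite := by
  by_contra hinf
  obtain ⟨n, hn⟩ := exists_nat_gt (ff 0 * ((8/5*(r+2)+τ)^3 * kap) / brk τ r)
  obtain ⟨t, ht, hc⟩ := Set.Infinite.exists_subset_card_eq hinf n
  have h := card_bound X hX c r τ hr hτ t (fun x hx => ht hx)
  rw [div_lt_iff₀ hb, ← hc] at hn
  linarith

theorem BB_norm {x : V3} (hx : x ∈ BB) : ‖x‖ ≤ 2 := by
  have hx : |x 0| ^ 3 + |x 1| ^ 3 + |x 2| ^ 3 ≤ 1 := hx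
  have p0 : 0 ≤ |x 0|^3 := by positivity
  have p1 : 0 ≤ |x 1|^3 := by positivity
  have p2 : 0 ≤ |x 2|^3 := by positivity
  have q : ∀ t : ℝ, |t|^3 ≤ 1 → t^2 ≤ 1 := by
    intro t ht
    have : |t| ≤ 1 := by
      by_contra! h
      have := one_lt_pow₀ h (n := 3) (by norm_num)
      linarith
    rw [← sq_abs]
    exact pow_le_one₀ (abs_nonneg _) this
  have := q _ (by linarith : |x 0|^3 ≤ 1)
  have := q _ (by linarith : |x 1|^3 ≤ 1)
  have := q _ (by linarith : |x 2|^3 ≤ 1)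
  have e := EuclideanSpace.real_norm_sq_eq x
  rw [Fin.sum_univ_three] at e
  nlinarith [norm_nonneg x]

theorem BB_fin : volume BB ≠ ⊤ := by
  refine ((measure_mono (fun x hx => ?_)).trans_lt (measure_closedBall_lt_top (x := (0:V3)) (r := 2))).ne
  simpa using BB_norm hx

theorem ratio_bound (X : Set V3) (hX : IsTranslativePacking BB X) (c : V3) (r τ : ℝ) (hr : 0 < r) (hτ : 0 ≤ τ)
    (hb : 0 < brk τ r) :
    (volume (closedBall c r ∩ ⋃ x ∈ X, (fun z => x + z) '' BB) / volume (closedBall c r)).toReal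
      ≤ volume.real BB * (8/5)^3 * ff 0 * (((8/5*(r+2)+τ)/(8/5*r))^3) / brk τ r := by
  set S := (fin_X X hX c r τ hr hτ hb).toFinset with hS
  have hcard := card_bound X hX c r τ hr hτ S (fun x hx => by simpa [hS] using hx)
  have hsub : closedBall c r ∩ ⋃ x ∈ X, (fun z => x + z) '' BB ⊆ ⋃ x ∈ S, (fun z => x + z) '' BB := by
    rintro y ⟨hy, hy2⟩
    simp only [Set.mem_iUnion] at hy2 ⊢
    obtain ⟨x, hx, z, hz, rfl⟩ := hy2
    refine ⟨x, ?_, z, hz, rfl⟩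
    rw [hS, Set.Finite.mem_toFinset]
    refine ⟨hx, ?_⟩
    rw [mem_closedBall, dist_eq_norm] at *
    have h1 := norm_sub_le (x + z - c) z
    rw [show x + z - c - z = x - c by abel] at h1
    linarith [BB_norm hz]
  have hm : volume (closedBall c r ∩ ⋃ x ∈ X, (fun z => x + z) '' BB) ≤ S.card * volume BB := by
    refine (measure_mono hsub).trans ((measure_biUnion_finset_le _ _).trans ?_)
    have : ∀ x ∈ S, volume ((fun z => x + z) '' BB) ≤ volume BB := fun x _ => by
      rw [Set.image_add_left, measure_preimage_add]
    refine (Finset.sum_le_sum this).trans ?_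
    simp
  have hm2 : (volume (closedBall c r ∩ ⋃ x ∈ X, (fun z => x + z) '' BB)).toReal ≤ S.card * volume.real BB := by
    have := ENNReal.toReal_mono (ENNReal.mul_ne_top (ENNReal.natCast_ne_top _) BB_fin) hm
    simpa [measureReal_def] using this
  rw [ENNReal.toReal_div]
  change _ / volume.real (closedBall c r) ≤ _
  rw [vol_ball c hr.le]
  have hk := kap_pos
  rw [div_le_div_iff₀ (by positivity) hb]
  have hv : 0 ≤ volume.real BB := measureReal_nonneg
  calc _ ≤ S.card * volume.real BB * brk τ r := mul_le_mul_of_nonneg_right hm2 hb.le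
    _ = volume.real BB * (S.card * brk τ r) := by ring
    _ ≤ volume.real BB * (ff 0 * ((8/5*(r+2)+τ)^3 * kap)) := mul_le_mul_of_nonneg_left hcard hv
    _ = _ := by field_simp

theorem eta_tendsto : Tendsto (fun n : ℕ => eta n) atTop (𝓝 0) := by
  have h := tendsto_setIntegral_of_antitone (μ := (volume : Measure V3)) (f := fun z => |ff z|)
    (s := fun n : ℕ => (closedBall (0:V3) n)ᶜ) (fun n => measurableSet_closedBall.compl)
    (fun a b hab => Set.compl_subset_compl.2 (closedBall_subset_closedBall (by exact_mod_cast hab)))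
    ⟨0, ff_int.abs.integrableOn⟩
  have e : (⋂ n : ℕ, (closedBall (0:V3) n)ᶜ) = ∅ := by
    ext x
    simp only [Set.mem_iInter, Set.mem_compl_iff, mem_closedBall, dist_zero_right, Set.mem_empty_iff_false, iff_false, not_forall, not_not]
    obtain ⟨n, hn⟩ := exists_nat_ge ‖x‖
    exact ⟨n, hn⟩
  rw [e] at h
  simpa [eta] using h

theorem lim_aux (a b c d : ℝ) (hc : 0 < c) (ha : a = c) : Tendsto (fun r : ℝ => (a * r + b) / (c * r + d)) atTop (𝓝 1) := by
  subst ha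
  have h1 : Tendsto (fun r : ℝ => a * r + d) atTop atTop :=
    tendsto_atTop_add_const_right _ _ (tendsto_id.const_mul_atTop hc)
  have h2 : Tendsto (fun r : ℝ => (b - d) / (a * r + d)) atTop (𝓝 0) := h1.const_div_atTop _
  have h3 := h2.const_add 1
  rw [add_zero] at h3
  refine h3.congr' ?_
  filter_upwards [h1.eventually_gt_atTop 0] with r hr
  field_simp; ring

theorem final (X : Set V3) (hX : IsTranslativePacking BB X)
    (hc : volume.real BB * (8/5)^3 * ff 0 < 0.8237 * II) : packingUpperDensity BB X ≤ 0.8237 := by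
  set C := volume.real BB * (8/5)^3 * ff 0 with hC
  obtain ⟨τ, hτ, h1, h2⟩ : ∃ τ : ℝ, 0 ≤ τ ∧ 0 < II - 3 * eta τ ∧ C < 0.8237 * (II - 3 * eta τ) := by
    have t1 : Tendsto (fun n : ℕ => II - 3 * eta n) atTop (𝓝 (II - 3 * 0)) := (eta_tendsto.const_mul 3).const_sub _
    rw [mul_zero, sub_zero] at t1
    have t2 := t1.const_mul (0.8237:ℝ)
    obtain ⟨n, a, b⟩ := ((t1.eventually_const_lt II_pos).and (t2.eventually_const_lt hc)).exists
    exact ⟨n, Nat.cast_nonneg _, a, b⟩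
  have L1 : Tendsto (fun r : ℝ => brk τ r) atTop (𝓝 (II - 3 * eta τ)) := by
    have := lim_aux (8/5) (16/5) (8/5) (16/5+τ) (by norm_num) rfl
    have := (((this.pow 3).const_sub 1).mul_const AC).const_sub (II - 3 * eta τ)
    rw [one_pow, sub_self, zero_mul, sub_zero] at this
    refine this.congr fun r => ?_
    unfold brk
    rw [show 8/5*(r+2) = 8/5*r + 16/5 by ring, add_assoc]
  have L2 : Tendsto (fun r : ℝ => C * (((8/5*(r+2)+τ)/(8/5*r))^3) / brk τ r) atTop (𝓝 (C / (II - 3 * eta τ))) := by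
    have := lim_aux (8/5) (16/5+τ) (8/5) 0 (by norm_num) rfl
    have := ((this.pow 3).const_mul C).div L1 h1.ne'
    rw [one_pow, mul_one] at this
    refine this.congr fun r => ?_
    rw [Pi.div_apply, add_zero, show 8/5*(r+2)+τ = 8/5*r + (16/5+τ) by ring]
  have hlt : C / (II - 3 * eta τ) < 0.8237 := by rw [div_lt_iff₀ h1]; exact h2
  unfold packingUpperDensity
  refine limsup_le_of_le ?_ ?_
  · refine IsBoundedUnder.isCoboundedUnder_le ?_
    refine isBoundedUnder_of ⟨0, fun r => ?_⟩
    exact Real.iSup_nonneg fun c => ENNReal.toReal_nonneg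
  · filter_upwards [eventually_gt_atTop 0, L1.eventually_const_lt h1, L2.eventually_lt_const hlt] with r hr hb hl
    exact ciSup_le fun c => (ratio_bound X hX c r τ hr hτ hb).trans hl.le
end SB

namespace SB
def uv (n : ℕ) : ℕ × ℕ :=
  Nat.rec (motive := fun _ => ℕ × ℕ) (1, 1) (fun m p => (p.1 * (3*(m+1)), p.2 * (3*(m+1)+1))) n
theorem uv_succ (n : ℕ) : uv (n+1) = ((uv n).1 * (3*(n+1)), (uv n).2 * (3*(n+1)+1)) := rfl

theorem uv_num : 100000 * (1001 * (uv 1000).1^3) ≤ 71235 * (uv 1000).2^3 := by decide +kernel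

theorem uv_pos (n : ℕ) : 0 < (uv n).1 ∧ 0 < (uv n).2 := by
  induction n with
  | zero => exact ⟨one_pos, one_pos⟩
  | succ n ih => rw [uv_succ]; exact ⟨Nat.mul_pos ih.1 (by omega), Nat.mul_pos ih.2 (by omega)⟩

theorem uv_log (n : ℕ) : Real.log (n.factorial) - ∑ m ∈ Finset.range (n+1), Real.log (1/3 + m) =
    Real.log 3 + Real.log (uv n).1 - Real.log (uv n).2 := by
  induction n with
  | zero => simp [uv]
  | succ n ih =>
    rw [Finset.sum_range_succ, uv_succ, Nat.factorial_succ]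
    have h1 := (uv_pos n).1
    have h2 := (uv_pos n).2
    have h3 := Nat.factorial_pos n
    push_cast
    rw [Real.log_mul (by positivity) (by positivity), Real.log_mul (by positivity) (by positivity),
      Real.log_mul (by positivity) (by positivity), Real.log_mul (by positivity) (by positivity)]
    rw [show (1/3 + ((n:ℝ)+1)) = (3*((n:ℝ)+1)+1)/3 by ring, Real.log_div (by positivity) (by positivity)]
    linarith

theorem gamma_le : Real.Gamma (4/3)^3 ≤ 0.71235 := by
  have h := Real.BohrMollerup.le_logGammaSeq (f := Real.log ∘ Real.Gamma) Real.convexOn_log_Gamma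
    (fun {y} hy => by
      rw [Function.comp_apply, Real.Gamma_add_one hy.ne', Real.log_mul hy.ne' (Real.Gamma_pos_of_pos hy).ne', add_comm]; rfl)
    (x := 1/3) (by norm_num) (by norm_num) 1000
  simp only [Function.comp_apply, Real.Gamma_one, Real.log_one, Real.BohrMollerup.logGammaSeq] at h
  have e := uv_log 1000
  have h1 := (uv_pos 1000).1
  have h2 := (uv_pos 1000).2
  have hn := uv_num
  generalize (uv 1000).1 = u at *
  generalize (uv 1000).2 = v at *
  have hG : Real.Gamma (4/3) = 1/3 * Real.Gamma (1/3) := by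
    rw [← Real.Gamma_add_one (by norm_num)]; norm_num
  have hp : 0 < Real.Gamma (1/3) := Real.Gamma_pos_of_pos (by norm_num)
  have hv : (0:ℝ) < v := by exact_mod_cast h2
  have hu : (0:ℝ) < u := by exact_mod_cast h1
  have hlog : Real.log (Real.Gamma (4/3)^3) ≤ Real.log (1001 * (u:ℝ)^3 / (v:ℝ)^3) := by
    have l1 : Real.log (1001 * (u:ℝ)^3 / (v:ℝ)^3) = Real.log 1001 + 3 * Real.log u - 3 * Real.log v := by
      rw [Real.log_div (by positivity) (by positivity),
        Real.log_mul (by positivity) (by positivity), Real.log_pow, Real.log_pow]; norm_num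
    have l2 : Real.log (Real.Gamma (4/3)^3) = 3 * (Real.log (Real.Gamma (1/3)) - Real.log 3) := by
      rw [hG, Real.log_pow, Real.log_mul (by norm_num) hp.ne', Real.log_div (by norm_num) (by norm_num), Real.log_one]
      push_cast; ring
    rw [l1, l2]
    have e1 : (((1000:ℕ):ℝ) + 1) = 1001 := by norm_num
    rw [e1] at h
    linarith
  have h5 := (Real.log_le_log_iff (by rw [hG]; positivity) (by positivity)).1 hlog
  refine h5.trans ?_
  rw [div_le_iff₀ (by positivity)]
  have : (100000:ℝ) * (1001 * (u:ℝ)^3) ≤ 71235 * (v:ℝ)^3 := by exact_mod_cast hn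
  linarith

theorem vol_BB : volume.real BB = 8 * Real.Gamma (4/3)^3 := by
  have h := MeasureTheory.volume_sum_rpow_le (Fin 3) (p := 3) (by norm_num) 1
  have mp := EuclideanSpace.volume_preserving_symm_measurableEquiv_toLp (Fin 3)
  have e : BB = (MeasurableEquiv.toLp 2 (Fin 3 → ℝ)).symm ⁻¹' {x : Fin 3 → ℝ | (∑ i, |x i| ^ (3:ℝ)) ^ (1/(3:ℝ)) ≤ 1} := by
    ext x
    simp only [BB, Set.mem_ofPred_eq, Set.mem_preimage, Fin.sum_univ_three]
    have e3 : ∀ t : ℝ, |t|^(3:ℝ) = |t|^3 := fun t => by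
      rw [show (3:ℝ) = ((3:ℕ):ℝ) by norm_num, Real.rpow_natCast]
    simp only [e3]
    rw [one_div, Real.rpow_inv_le_iff_of_pos (by positivity) (by norm_num) (by norm_num), Real.one_rpow]
    rfl
  rw [measureReal_def, e, mp.measure_preimage_equiv, h]
  simp only [Fintype.card_fin, ENNReal.ofReal_one, one_pow, one_mul]
  rw [show (1/(3:ℝ)+1) = 4/3 by norm_num, show (((3:ℕ):ℝ)/3 + 1) = 1 + 1 by norm_num, Real.Gamma_add_one one_ne_zero, Real.Gamma_one]
  have : 0 < Real.Gamma (4/3) := Real.Gamma_pos_of_pos (by norm_num)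
  rw [ENNReal.toReal_ofReal (by positivity)]
  ring

theorem sqrt_ge : (2.50662:ℝ) ≤ Real.sqrt (2*Real.pi) := by
  apply Real.le_sqrt_of_sq_le
  have := Real.pi_gt_d6
  norm_num at *; linarith

theorem const_lt : volume.real BB * (8/5)^3 * ff 0 < 0.8237 * II := by
  unfold II
  rw [ff_integral, ww_zero, ff_zero, vol_BB]
  have hK : (2.50662:ℝ)^3 ≤ KK := pow_le_pow_left₀ (by norm_num) sqrt_ge 3
  have hG := gamma_le
  norm_num at *; linarith
end SB

/-- Every translative packing of the superball `B³₃` has upper density at most `0.8237`. -/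
theorem superball3_translative_packing_bound
    (B : Set (EuclideanSpace ℝ (Fin 3)))
    (hB : B = {x : EuclideanSpace ℝ (Fin 3) | |x 0| ^ 3 + |x 1| ^ 3 + |x 2| ^ 3 ≤ 1})
    (X : Set (EuclideanSpace ℝ (Fin 3))) (hX : IsTranslativePacking B X) :
    packingUpperDensity B X ≤ 0.8237 := by
  subst hB
  exact SB.final X hX SB.const_lt
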